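/- arXiv:math/0109206 — 4 statements merged into one kernel-verified Lean document; each statement's English description precedes it below -/
import Mathlib

section
/- (Plancherel–Pólya) Let 0 < p < ∞ and let f be an entire function of exponential type π whose restriction to the real axis lies in L^p(ℝ). Then for every y ∈ ℝ one has ∫_{-∞}^{∞} |f(x+iy)|^p dx ≤ e^{pπ|y|} ∫_{-∞}^{∞} |f(x)|^p dx. -/
open MeasureTheory Real Complex
open scoped ENNReal NNReal

/-- An entire function of exponential type `π`. -/
def ExpTypePi (f : ℂ → ℂ) : Prop :=
  Differentiable ℂ f ∧
    ∀ ε > 0, ∃ C > 0, ∀ z : ℂ, ‖f z‖ ≤ C * Real.exp ((Real.pi + ε) * ‖z‖)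


theorem pp_submean {F : ℂ → ℂ} {c : ℂ} {r p : ℝ} (hr : 0 < r) (hp : 0 < p)
    (hF : AnalyticOnNhd ℂ F (Metric.closedBall c r)) :
    ‖F c‖ ^ p ≤ circleAverage (fun z => ‖F z‖ ^ p) c r := by
  by_cases h0 : F c = 0
  · rw [h0, norm_zero, Real.zero_rpow hp.ne']
    exact circleAverage_nonneg_of_nonneg (fun z _ => by positivity)
  have habs : |r| = r := abs_of_pos hr
  have hF' : AnalyticOnNhd ℂ F (Metric.closedBall c |r|) := by rwa [habs]
  have hJ := hF'.circleAverage_log_norm hr.ne' h0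
  have hlog : Real.log ‖F c‖ ≤ circleAverage (Real.log ‖F ·‖) c r := by
    rw [hJ]
    have : 0 ≤ ∑ᶠ u, MeromorphicOn.divisor F (Metric.closedBall c |r|) u * Real.log (r * ‖c - u‖⁻¹) := by
      apply finsum_nonneg
      intro u
      by_cases hu : u ∈ Metric.closedBall c |r|
      · by_cases hcu : u = c
        · simp [hcu]
        apply mul_nonneg
        · exact_mod_cast MeromorphicOn.AnalyticOnNhd.divisor_nonneg hF' u
        · apply Real.log_nonneg
          have h1 : 0 < ‖c - u‖ := norm_pos_iff.2 (sub_ne_zero.2 (Ne.symm hcu))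
          rw [habs, Metric.mem_closedBall, dist_comm, dist_eq_norm] at hu
          rw [← div_eq_mul_inv, le_div_iff₀ h1]; linarith
      · simp [hu]
    linarith
  have hi : CircleIntegrable (Real.log ‖F ·‖) c r :=
    (hF'.mono Metric.sphere_subset_closedBall).meromorphicOn.circleIntegrable_log_norm
  set a := Real.log ‖F c‖ with ha
  set A := ‖F c‖ ^ p with hA
  have hA0 : 0 < A := Real.rpow_pos_of_pos (norm_pos_iff.2 h0) _
  set L : ℂ → ℝ := fun z => A * (1 - p * a) + (A * p) • Real.log ‖F z‖ with hL
  have hi2 : CircleIntegrable (fun z => (A * p) • Real.log ‖F z‖) c r := hi.const_smul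
  have hLi : CircleIntegrable L c r := (circleIntegrable_const _ _ _).add hi2
  have hpi : CircleIntegrable (fun z => ‖F z‖ ^ p) c r := by
    apply ContinuousOn.circleIntegrable hr.le
    have : ContinuousOn F (Metric.sphere c r) := hF.continuousOn.mono Metric.sphere_subset_closedBall
    exact this.norm.rpow_const (fun _ _ => Or.inr hp.le)
  have hLA : A ≤ circleAverage L c r := by
    rw [hL, circleAverage_fun_add (circleIntegrable_const _ _ _) hi2, circleAverage_const, circleAverage_fun_smul]
    simp only [smul_eq_mul]
    nlinarith [mul_le_mul_of_nonneg_left hlog (mul_pos hA0 hp).le]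
  have hkey : ∀ z, F z ≠ 0 → L z ≤ ‖F z‖ ^ p := by
    intro z hz
    have e1 : ‖F z‖ ^ p = A * Real.exp (p * (Real.log ‖F z‖ - a)) := by
      rw [hA, Real.rpow_def_of_pos (norm_pos_iff.2 h0), Real.rpow_def_of_pos (norm_pos_iff.2 hz), ← Real.exp_add]
      congr 1; rw [ha]; ring
    rw [e1]
    have := Real.add_one_le_exp (p * (Real.log ‖F z‖ - a))
    have := mul_le_mul_of_nonneg_left this hA0.le
    simp only [hL, smul_eq_mul]
    nlinarith
  have hcod : L =ᶠ[Filter.codiscreteWithin (Metric.sphere c |r|)] (fun z => min (L z) (‖F z‖ ^ p)) := by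
    have h1 : {z | F z ≠ 0} ∈ Filter.codiscreteWithin (Metric.closedBall c |r|) := by
      exact hF'.preimage_zero_mem_codiscreteWithin h0 (by simp)
        ((convex_closedBall c |r|).isConnected ⟨c, by simp⟩)
    filter_upwards [Filter.codiscreteWithin_mono Metric.sphere_subset_closedBall h1] with z hz
    exact (min_eq_left (hkey z hz)).symm
  refine hLA.trans ?_
  rw [circleAverage_congr_codiscreteWithin hcod hr.ne']
  exact circleAverage_mono (hLi.congr_codiscreteWithin hcod) hpi (fun z _ => min_le_right _ _)

theorem pp_maxprinciple {U : Set ℂ} (hU : IsOpen U) (hb : Bornology.IsBounded U) {w : ℂ → ℝ}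
    (hw : ContinuousOn w (closure U))
    (hsub : ∀ c r, 0 < r → Metric.closedBall c r ⊆ U → w c ≤ circleAverage w c r) {K : ℝ}
    (hK : ∀ z ∈ closure U \ U, w z ≤ K) : ∀ z ∈ U, w z ≤ K := by
  intro z hz
  by_contra! hlt
  have hc : IsCompact (closure U) := hb.isCompact_closure
  obtain ⟨z0, hz0, hmax⟩ := hc.exists_isMaxOn ⟨z, subset_closure hz⟩ hw
  have hmax' : ∀ x ∈ closure U, w x ≤ w z0 := fun x hx => hmax hx
  set T : Set ℂ := closure U ∩ w ⁻¹' {w z0} with hT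
  have hTc : IsCompact T := by
    apply hc.of_isClosed_subset _ Set.inter_subset_left
    exact hw.preimage_isClosed_of_isClosed isClosed_closure isClosed_singleton
  obtain ⟨z1, hz1, hre⟩ := hTc.exists_isMaxOn ⟨z0, hz0, rfl⟩ Complex.continuous_re.continuousOn
  have hre' : ∀ x ∈ T, x.re ≤ z1.re := fun x hx => hre hx
  have hw1 : w z1 = w z0 := hz1.2
  have hz1U : z1 ∈ U := by
    by_contra hn
    have h1 := hK z1 ⟨hz1.1, hn⟩
    have h2 := hmax' z (subset_closure hz)
    linarith
  obtain ⟨r, hr, hball⟩ := Metric.nhds_basis_closedBall.mem_iff.1 (hU.mem_nhds hz1U)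
  have hcm : ∀ θ, circleMap z1 r θ ∈ closure U := fun θ =>
    subset_closure (hball (circleMap_mem_closedBall z1 hr.le θ))
  have hs := hsub z1 r hr hball
  have hcont : Continuous (fun θ => w (circleMap z1 r θ)) := by
    apply hw.comp_continuous (continuous_circleMap z1 r) hcm
  have h0 : w (circleMap z1 r 0) < w z0 := by
    refine lt_of_le_of_ne (hmax' _ (hcm 0)) (fun heq => ?_)
    have := hre' _ ⟨hcm 0, heq⟩
    simp [circleMap] at this
    linarith
  have hI := intervalIntegral.integral_lt_integral_of_continuousOn_of_le_of_exists_lt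
    (f := fun θ => w (circleMap z1 r θ)) (g := fun _ => w z0) Real.two_pi_pos hcont.continuousOn
    continuousOn_const (fun θ _ => hmax' _ (hcm θ)) ⟨0, ⟨le_rfl, Real.two_pi_pos.le⟩, h0⟩
  rw [circleAverage_def, hw1, smul_eq_mul, inv_mul_eq_div, le_div_iff₀ Real.two_pi_pos] at hs
  simp at hI
  linarith

def PPClass (v : ℂ → ℝ) : Prop :=
  ∀ U : Set ℂ, IsOpen U → Bornology.IsBounded U → ∀ h : ℂ → ℂ,
    (∀ z ∈ closure U, DifferentiableAt ℂ h z) → ∀ K : ℝ,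
    (∀ z ∈ closure U \ U, v z * Real.exp (h z).re ≤ K) → ∀ z ∈ U, v z * Real.exp (h z).re ≤ K

noncomputable def ppv (f : ℂ → ℂ) (p N : ℝ) (z : ℂ) : ℝ := ∫ t in (-N)..N, ‖f (z + t)‖ ^ p

theorem ppv_continuous {f : ℂ → ℂ} (hf : Continuous f) {p : ℝ} (hp : 0 < p) (N : ℝ) :
    Continuous (ppv f p N) := by
  apply intervalIntegral.continuous_parametric_intervalIntegral_of_continuous'
  have : Continuous (fun q : ℂ × ℝ => ‖f (q.1 + q.2)‖) := by fun_prop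
  exact this.rpow_const (fun _ => Or.inr hp.le)

theorem pp_cswap {G : ℝ → ℝ → ℝ} (hG : Continuous (fun q : ℝ × ℝ => G q.1 q.2)) :
    Continuous (fun q : ℝ × ℝ => G q.2 q.1) := hG.comp continuous_swap

theorem pp_swap {G : ℝ → ℝ → ℝ} (hG : Continuous (fun q : ℝ × ℝ => G q.1 q.2)) (a b c d : ℝ) :
    ∫ x in a..b, ∫ y in c..d, G x y = ∫ y in c..d, ∫ x in a..b, G x y := by
  apply intervalIntegral_intervalIntegral_swap
  have hk : IsCompact (Set.uIcc a b ×ˢ Set.uIcc c d) := isCompact_uIcc.prod isCompact_uIcc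
  have h1 : IntegrableOn (Function.uncurry G) (Set.uIcc a b ×ˢ Set.uIcc c d) :=
    ContinuousOn.integrableOn_compact hk (Continuous.continuousOn hG)
  exact h1.mono_set (Set.prod_mono Set.uIoc_subset_uIcc Set.uIoc_subset_uIcc)

theorem ppv_submean {f : ℂ → ℂ} (hf : Differentiable ℂ f) {p : ℝ} (hp : 0 < p) (N : ℝ) (hN : 0 ≤ N)
    {h : ℂ → ℂ} {c : ℂ} {r : ℝ} (hr : 0 < r) (hhan : AnalyticOnNhd ℂ h (Metric.closedBall c r)) :
    ppv f p N c * Real.exp (h c).re ≤ circleAverage (fun z => ppv f p N z * Real.exp (h z).re) c r := by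
  have hnorm : ∀ (t : ℝ) (z : ℂ), ‖f (z + t)‖ ^ p * Real.exp (h z).re
      = ‖f (z + t) * Complex.exp (h z / p)‖ ^ p := by
    intro t z
    rw [norm_mul, Complex.norm_exp, Real.mul_rpow (by positivity) (by positivity), ← Real.exp_mul]
    congr 2
    rw [Complex.div_ofReal_re]; field_simp
  have hsm : ∀ t : ℝ, ‖f (c + t)‖ ^ p * Real.exp (h c).re ≤
      circleAverage (fun z => ‖f (z + t)‖ ^ p * Real.exp (h z).re) c r := by
    intro t
    simp only [hnorm t]
    apply pp_submean hr hp (F := fun z => f (z + t) * Complex.exp (h z / p))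
    apply AnalyticOnNhd.mul
    · have : Differentiable ℂ (fun z : ℂ => f (z + t)) := by fun_prop
      exact fun z _ => this.analyticAt z
    · intro z hz
      exact ((hhan z hz).div_const).cexp
  have hcont : Continuous (fun q : ℝ × ℝ => ‖f (circleMap c r q.1 + q.2)‖ ^ p * Real.exp (h (circleMap c r q.1)).re) := by
    apply Continuous.mul
    · have : Continuous (fun q : ℝ × ℝ => ‖f (circleMap c r q.1 + q.2)‖) := by
        have := hf.continuous
        fun_prop
      exact this.rpow_const (fun _ => Or.inr hp.le)
    · have : Continuous (fun θ : ℝ => h (circleMap c r θ)) :=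
        hhan.continuousOn.comp_continuous (continuous_circleMap c r)
          (fun θ => circleMap_mem_closedBall c hr.le θ)
      exact Real.continuous_exp.comp (Complex.continuous_re.comp (this.comp continuous_fst))
  have hcont2 : Continuous (fun q : ℝ × ℝ => ‖f (circleMap c r q.2 + q.1)‖ ^ p * Real.exp (h (circleMap c r q.2)).re) :=
    pp_cswap (G := fun θ t : ℝ => ‖f (circleMap c r θ + t)‖ ^ p * Real.exp (h (circleMap c r θ)).re) hcont
  have e1 : circleAverage (fun z => ppv f p N z * Real.exp (h z).re) c r
      = ∫ t in (-N)..N, circleAverage (fun z => ‖f (z + t)‖ ^ p * Real.exp (h z).re) c r := by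
    simp only [circleAverage_def, ppv, ← intervalIntegral.integral_mul_const, smul_eq_mul,
      intervalIntegral.integral_const_mul]
    congr 1
    exact pp_swap (G := fun θ t : ℝ => ‖f (circleMap c r θ + t)‖ ^ p * Real.exp (h (circleMap c r θ)).re) hcont _ _ _ _
  rw [e1, ppv, ← intervalIntegral.integral_mul_const]
  apply intervalIntegral.integral_mono_on (by linarith)
  · apply Continuous.intervalIntegrable
    have : Continuous (fun t : ℝ => ‖f (c + t)‖) := by
      have := hf.continuous
      fun_prop
    exact (this.rpow_const (fun _ => Or.inr hp.le)).mul_const _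
  · apply Continuous.intervalIntegrable
    simp only [circleAverage_def]
    refine Continuous.fun_const_smul ?_ _
    exact intervalIntegral.continuous_parametric_intervalIntegral_of_continuous' (f := fun t θ : ℝ => ‖f (circleMap c r θ + t)‖ ^ p * Real.exp (h (circleMap c r θ)).re) hcont2 _ _
  · exact fun t _ => hsm t

theorem ppv_class {f : ℂ → ℂ} (hf : Differentiable ℂ f) {p : ℝ} (hp : 0 < p) (N : ℝ) (hN : 0 ≤ N) :
    PPClass (ppv f p N) := by
  intro U hU hb h hh K hK
  refine pp_maxprinciple hU hb (w := fun z => ppv f p N z * Real.exp (h z).re) ?_ ?_ hK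
  · have h1 : ContinuousOn h (closure U) := fun z hz => (hh z hz).continuousAt.continuousWithinAt
    apply (ppv_continuous hf.continuous hp N).continuousOn.mul
    exact Real.continuous_exp.comp_continuousOn (Complex.continuous_re.comp_continuousOn h1)
  intro c r hr hball
  have hdU : DifferentiableOn ℂ h U := fun z hz => (hh z (subset_closure hz)).differentiableWithinAt
  have hhan : AnalyticOnNhd ℂ h (Metric.closedBall c r) := (hdU.analyticOnNhd hU).mono hball
  exact ppv_submean hf hp N hN hr hhan

theorem pp_PL {v : ℂ → ℝ} (hv : PPClass v) {U T : Set ℂ} (hU : IsOpen U)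
    (hT : IsClosed T) (hUT : U ⊆ T) {h g : ℂ → ℂ} (hh : ∀ z ∈ T, DifferentiableAt ℂ h z)
    (hg : ∀ z ∈ T, DifferentiableAt ℂ g z) (hv0 : ∀ z, 0 ≤ v z) {K : ℝ}
    (hg0 : ∀ z ∈ T, (g z).re ≤ 0)
    (hK : ∀ z ∈ T \ U, v z * Real.exp (h z).re ≤ K)
    (hinf : ∀ ε > 0, ∃ R, ∀ z ∈ T, R ≤ ‖z‖ → v z * Real.exp ((h z).re + ε * (g z).re) ≤ K) :
    ∀ z ∈ T, v z * Real.exp (h z).re ≤ K := by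
  intro z hzT
  by_cases hz : z ∈ U
  swap
  · exact hK z ⟨hzT, hz⟩
  have hε : ∀ ε > 0, v z * Real.exp ((h z).re + ε * (g z).re) ≤ K := by
    intro ε he
    obtain ⟨R, hR⟩ := hinf ε he
    have hcl : closure (U ∩ Metric.ball 0 (max R (‖z‖ + 1))) ⊆ T :=
      (closure_mono Set.inter_subset_left).trans ((closure_mono hUT).trans hT.closure_eq.subset)
    have := hv (U ∩ Metric.ball 0 (max R (‖z‖ + 1))) (hU.inter Metric.isOpen_ball)
      (Metric.isBounded_ball.subset Set.inter_subset_right) (fun z => h z + ε * g z)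
      (fun w hw => (hh w (hcl hw)).add ((hg w (hcl hw)).const_mul _)) K ?_ z
      ⟨hz, by simp⟩
    · simpa using this
    · rintro w ⟨hw1, hw2⟩
      have hwT := hcl hw1
      have hre : (h w + ε * g w).re = (h w).re + ε * (g w).re := by simp
      rw [hre]
      by_cases hwU : w ∈ U
      · apply hR w hwT
        by_contra! hlt
        apply hw2
        exact ⟨hwU, by simp [hlt]⟩
      · refine le_trans ?_ (hK w ⟨hwT, hwU⟩)
        apply mul_le_mul_of_nonneg_left _ (hv0 w)
        apply Real.exp_le_exp.2
        nlinarith [hg0 w hwT]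
  have hlim : Filter.Tendsto (fun ε : ℝ => v z * Real.exp ((h z).re + ε * (g z).re))
      (nhdsWithin 0 (Set.Ioi 0)) (nhds (v z * Real.exp ((h z).re + 0 * (g z).re))) := by
    apply Filter.Tendsto.mono_left _ nhdsWithin_le_nhds
    apply Continuous.tendsto (f := fun ε : ℝ => v z * Real.exp ((h z).re + ε * (g z).re))
    fun_prop
  have := le_of_tendsto hlim (Filter.eventually_of_mem self_mem_nhdsWithin hε)
  simpa using this

noncomputable def ppg (z : ℂ) : ℂ :=
  -Complex.exp (((-(3 * π / 8) : ℝ) : ℂ) * I + ((3 / 2 : ℝ) : ℂ) * Complex.log (z + 1 + I))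

theorem ppg_diff {z : ℂ} (h1 : 0 ≤ z.re) : DifferentiableAt ℂ ppg z := by
  unfold ppg
  apply DifferentiableAt.fun_neg
  apply DifferentiableAt.cexp
  apply DifferentiableAt.const_add
  apply DifferentiableAt.const_mul
  apply DifferentiableAt.clog (by fun_prop)
  left
  simp; linarith

theorem ppg_re {z : ℂ} (h1 : 0 ≤ z.re) (h2 : 0 ≤ z.im) :
    (ppg z).re ≤ -(Real.cos (3 * π / 8) * (‖z‖ * √‖z‖)) := by
  set ζ := z + 1 + I with hζ
  have hre : ζ.re = z.re + 1 := by simp [hζ]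
  have him : ζ.im = z.im + 1 := by simp [hζ]
  have hn : ‖z‖ ≤ ‖ζ‖ := by
    rw [Complex.norm_def, Complex.norm_def]
    apply Real.sqrt_le_sqrt
    rw [Complex.normSq_apply, Complex.normSq_apply, hre, him]
    nlinarith
  have hζ0 : 0 < ‖ζ‖ := by
    apply norm_pos_iff.2
    intro h0
    rw [h0] at hre
    simp at hre; linarith
  have harg0 : 0 ≤ ζ.arg := Complex.arg_nonneg_iff.2 (by rw [him]; linarith)
  have harg1 : ζ.arg ≤ π / 2 := (abs_le.1 (Complex.abs_arg_le_pi_div_two_iff.2 (by rw [hre]; linarith))).2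
  have e : (ppg z).re = -(Real.exp (3 / 2 * Real.log ‖ζ‖) * Real.cos (-(3 * π / 8) + 3 / 2 * ζ.arg)) := by
    unfold ppg
    rw [← hζ, Complex.neg_re, Complex.exp_re]
    simp only [Complex.add_re, Complex.add_im, Complex.re_ofReal_mul, Complex.im_ofReal_mul,
      Complex.I_re, Complex.I_im, Complex.log_re, Complex.log_im, mul_zero, mul_one, zero_add]
  rw [e, neg_le_neg_iff, mul_comm]
  have hcos : Real.cos (3 * π / 8) ≤ Real.cos (-(3 * π / 8) + 3 / 2 * ζ.arg) := by
    rw [← Real.cos_abs (-(3 * π / 8) + 3 / 2 * ζ.arg)]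
    apply Real.cos_le_cos_of_nonneg_of_le_pi (abs_nonneg _)
    · linarith [Real.pi_pos]
    · rw [abs_le]; constructor <;> linarith
  have hc0 : 0 ≤ Real.cos (3 * π / 8) := Real.cos_nonneg_of_mem_Icc ⟨by linarith [Real.pi_pos], by linarith [Real.pi_pos]⟩
  have hex : ‖z‖ * √‖z‖ ≤ Real.exp (3 / 2 * Real.log ‖ζ‖) := by
    have : Real.exp (3 / 2 * Real.log ‖ζ‖) = ‖ζ‖ * √‖ζ‖ := by
      rw [show 3 / 2 * Real.log ‖ζ‖ = Real.log ‖ζ‖ + Real.log ‖ζ‖ / 2 by ring, Real.exp_add, ← Real.log_sqrt hζ0.le,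
        Real.exp_log hζ0, Real.exp_log (Real.sqrt_pos.2 hζ0)]
    rw [this]
    gcongr
  rw [mul_comm (Real.exp _)]
  rw [mul_comm (‖z‖ * √‖z‖)]
  exact mul_le_mul hcos hex (by positivity) (hc0.trans hcos)

theorem pp_quad {v : ℂ → ℝ} (hv : PPClass v) (hv0 : ∀ z, 0 ≤ v z) {c : ℂ} (hc : ‖c‖ = 1)
    {h : ℂ → ℂ} (hh : Differentiable ℂ h) {b C K : ℝ} (hb : 0 < b) (hC : 0 ≤ C) (hCK : C ≤ K)
    (hgrow : ∀ z, v z ≤ C * Real.exp (b * ‖z‖))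
    (hneg : ∀ z : ℂ, 0 ≤ (c * z).re → 0 ≤ (c * z).im → (h z).re ≤ 0)
    (hK1 : ∀ z : ℂ, (c * z).re = 0 → 0 ≤ (c * z).im → v z * Real.exp (h z).re ≤ K)
    (hK2 : ∀ z : ℂ, 0 ≤ (c * z).re → (c * z).im = 0 → v z * Real.exp (h z).re ≤ K) :
    ∀ z : ℂ, 0 ≤ (c * z).re → 0 ≤ (c * z).im → v z * Real.exp (h z).re ≤ K := by
  intro z hz1 hz2
  have hk : 0 < Real.cos (3 * π / 8) := Real.cos_pos_of_mem_Ioo ⟨by linarith [Real.pi_pos], by linarith [Real.pi_pos]⟩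
  set k := Real.cos (3 * π / 8) with hkdef
  have hnc : ∀ w : ℂ, ‖c * w‖ = ‖w‖ := fun w => by rw [norm_mul, hc, one_mul]
  have hgre : ∀ w : ℂ, 0 ≤ (c * w).re → 0 ≤ (c * w).im → (ppg (c * w)).re ≤ -(k * (‖w‖ * √‖w‖)) := by
    intro w h1 h2
    have := ppg_re h1 h2
    rwa [hnc] at this
  refine pp_PL hv (U := {w | 0 < (c * w).re ∧ 0 < (c * w).im})
    (T := {w | 0 ≤ (c * w).re ∧ 0 ≤ (c * w).im}) (h := h) (g := fun w => ppg (c * w))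
    ?_ ?_ ?_ ?_ ?_ hv0 ?_ ?_ ?_ z ⟨hz1, hz2⟩
  · exact IsOpen.and (isOpen_lt (by fun_prop) (by fun_prop)) (isOpen_lt (by fun_prop) (by fun_prop))
  · exact IsClosed.and (isClosed_le (by fun_prop) (by fun_prop)) (isClosed_le (by fun_prop) (by fun_prop))
  · exact fun w hw => ⟨hw.1.le, hw.2.le⟩
  · exact fun w _ => hh w
  · intro w hw
    exact DifferentiableAt.comp (g := ppg) w (ppg_diff hw.1) (by fun_prop)
  · intro w hw
    have := hgre w hw.1 hw.2
    have : 0 ≤ k * (‖w‖ * √‖w‖) := by positivity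
    linarith
  · rintro w ⟨⟨h1, h2⟩, h3⟩
    rcases h1.eq_or_lt with h1' | h1'
    · exact hK1 w h1'.symm h2
    rcases h2.eq_or_lt with h2' | h2'
    · exact hK2 w h1 h2'.symm
    exact absurd ⟨h1', h2'⟩ h3
  · intro ε he
    refine ⟨(b / (ε * k)) ^ 2, ?_⟩
    rintro w ⟨h1, h2⟩ hw
    have hs : b / (ε * k) ≤ √‖w‖ := Real.le_sqrt_of_sq_le hw
    have hs' : b ≤ √‖w‖ * (ε * k) := (div_le_iff₀ (by positivity)).1 hs
    have hg := hgre w h1 h2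
    have hn := hneg w h1 h2
    calc v w * Real.exp ((h w).re + ε * (ppg (c * w)).re)
        ≤ (C * Real.exp (b * ‖w‖)) * Real.exp (-(b * ‖w‖)) := by
          apply mul_le_mul (hgrow w) _ (by positivity) (by positivity)
          apply Real.exp_le_exp.2
          have h3 := mul_le_mul_of_nonneg_left hg he.le
          have h4 := mul_le_mul_of_nonneg_right hs' (norm_nonneg w)
          nlinarith
      _ = C := by rw [mul_assoc, ← Real.exp_add]; simp
      _ ≤ K := hCK

theorem pp_half {v : ℂ → ℝ} (hv : PPClass v) (hv0 : ∀ z, 0 ≤ v z) {b C M : ℝ}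
    (hb : 0 < b) (hC : 0 ≤ C) (hM : 0 < M) (hgrow : ∀ z, v z ≤ C * Real.exp (b * ‖z‖))
    (hreal : ∀ x : ℝ, v x ≤ M) (y : ℝ) (hy : 0 ≤ y) :
    v (y * I) ≤ M * Real.exp (b * y) := by
  set h : ℂ → ℂ := fun z => I * b * z with hh
  have hre : ∀ z, (h z).re = -(b * z.im) := by intro z; simp [hh]
  have hd : Differentiable ℂ h := by rw [hh]; fun_prop
  set K := max C M with hKd
  have hK0 : 0 < K := lt_max_of_lt_right hM
  have hr : ∀ z : ℂ, z.im = 0 → v z * Real.exp (h z).re ≤ M := by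
    intro z hz
    rw [hre, hz]
    have : z = (z.re : ℂ) := by apply Complex.ext <;> simp [hz]
    rw [this]; simpa using hreal z.re
  have hi : ∀ z : ℂ, z.re = 0 → 0 ≤ z.im → v z * Real.exp (h z).re ≤ C := by
    intro z hz hz2
    have hn : ‖z‖ = z.im := by
      have : z = (z.im : ℂ) * I := by apply Complex.ext <;> simp [hz]
      rw [this]; simp [abs_of_nonneg hz2]
    calc v z * Real.exp (h z).re ≤ C * Real.exp (b * ‖z‖) * Real.exp (h z).re :=
          mul_le_mul_of_nonneg_right (hgrow z) (Real.exp_pos _).le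
      _ = C := by rw [hre, hn, mul_assoc, ← Real.exp_add]; simp
  have hbdd : ∀ z : ℂ, 0 ≤ z.im → v z * Real.exp (h z).re ≤ K := by
    intro z hz
    rcases le_total 0 z.re with h1 | h1
    · refine pp_quad hv hv0 (c := 1) (by simp) hd hb hC (le_max_left C M) hgrow ?_ ?_ ?_ z (by simpa) (by simpa)
      · intro w _ h2; rw [hre]; simp at h2; nlinarith
      · intro w h2 h3; exact (hi w (by simpa using h2) (by simpa using h3)).trans (le_max_left _ _)
      · intro w h2 h3; exact (hr w (by simpa using h3)).trans (le_max_right _ _)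
    · refine pp_quad hv hv0 (c := -I) (by simp) hd hb hC (le_max_left C M) hgrow ?_ ?_ ?_ z (by simpa) (by simpa)
      · intro w h2 _; rw [hre]; simp at h2; nlinarith
      · intro w h2 h3; exact (hr w (by simpa using h2)).trans (le_max_right _ _)
      · intro w h2 h3; exact (hi w (by simpa using h3) (by simpa using h2)).trans (le_max_left _ _)
  have hn1 : ∀ z : ℂ, 0 ≤ z.im → 1 ≤ ‖1 - I * z‖ ∧ ‖z‖ ≤ ‖1 - I * z‖ := by
    intro z hz
    constructor
    · have := Complex.re_le_norm (1 - I * z)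
      simp at this; linarith
    · rw [Complex.norm_def, Complex.norm_def]
      apply Real.sqrt_le_sqrt
      rw [Complex.normSq_apply, Complex.normSq_apply]
      simp
      nlinarith
  have hfin := pp_PL hv (U := {z | 0 < z.im}) (T := {z | 0 ≤ z.im}) (h := h)
    (g := fun z => -Complex.log (1 - I * z)) (K := M)
    (isOpen_lt (by fun_prop) (by fun_prop)) (isClosed_le (by fun_prop) (by fun_prop))
    (fun z (hz : 0 < z.im) => hz.le) (fun z _ => hd z) ?_ hv0 ?_ ?_ ?_ (y * I) (by simpa using hy)
  · rw [hre] at hfin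
    simp at hfin
    rw [Real.exp_neg, ← div_eq_mul_inv, div_le_iff₀ (Real.exp_pos _)] at hfin
    exact hfin
  · intro z hz
    apply DifferentiableAt.fun_neg
    apply DifferentiableAt.clog (by fun_prop)
    left
    have : 0 ≤ z.im := hz
    simp; linarith
  · intro z hz
    rw [Complex.neg_re, Complex.log_re]
    linarith [Real.log_nonneg (hn1 z hz).1]
  · rintro z ⟨hz1, hz2⟩
    exact hr z (le_antisymm (not_lt.1 hz2) hz1)
  · intro ε he
    refine ⟨Real.exp (Real.log (K / M) / ε), ?_⟩
    intro z hz hzn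
    have h1 : Real.log (K / M) / ε ≤ Real.log ‖1 - I * z‖ := by
      have := hzn.trans (hn1 z hz).2
      rwa [Real.le_log_iff_exp_le (by linarith [(hn1 z hz).1])]
    have h2 : Real.log (K / M) ≤ ε * Real.log ‖1 - I * z‖ := by
      rw [div_le_iff₀ he] at h1; linarith
    rw [Real.exp_add, ← mul_assoc]
    calc v z * Real.exp (h z).re * Real.exp (ε * (-Complex.log (1 - I * z)).re)
        ≤ K * Real.exp (-Real.log (K / M)) := by
          apply mul_le_mul (hbdd z hz) _ (Real.exp_pos _).le hK0.le
          apply Real.exp_le_exp.2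
          rw [Complex.neg_re, Complex.log_re]; linarith
      _ = M := by rw [Real.exp_neg, Real.exp_log (by positivity)]; field_simp

theorem ppv_nonneg (f : ℂ → ℂ) (p : ℝ) {N : ℝ} (hN : 0 ≤ N) (z : ℂ) : 0 ≤ ppv f p N z :=
  intervalIntegral.integral_nonneg (by linarith) (fun t _ => by positivity)

theorem pp_cont {f : ℂ → ℂ} (hf : Continuous f) {p : ℝ} (hp : 0 < p) (z : ℂ) :
    Continuous (fun t : ℝ => ‖f (z + t)‖ ^ p) := by
  have : Continuous (fun t : ℝ => ‖f (z + t)‖) := by fun_prop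
  exact this.rpow_const (fun _ => Or.inr hp.le)

theorem pp_ofReal {f : ℂ → ℂ} (hf : Continuous f) {p : ℝ} (hp : 0 < p) {N : ℝ} (hN : 0 ≤ N) (z : ℂ) :
    ENNReal.ofReal (ppv f p N z) = ∫⁻ t : ℝ in Set.Ioc (-N) N, (‖f (z + t)‖₊ : ℝ≥0∞) ^ p := by
  have hint : IntervalIntegrable (fun t : ℝ => ‖f (z + t)‖ ^ p) volume (-N) N :=
    (pp_cont hf hp z).intervalIntegrable _ _
  rw [ppv, intervalIntegral.integral_of_le (by linarith),
    ofReal_integral_eq_lintegral_ofReal ((intervalIntegrable_iff_integrableOn_Ioc_of_le (by linarith)).1 hint)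
      (Filter.Eventually.of_forall (fun t => by positivity))]
  congr 1
  ext t
  rw [← ENNReal.ofReal_rpow_of_nonneg (norm_nonneg _) hp.le, ofReal_norm_eq_enorm]
  rfl

theorem pp_upper (p : ℝ) (hp : 0 < p) (f : ℂ → ℂ) (hf : ExpTypePi f)
    (hLp : (∫⁻ x : ℝ, (‖f x‖₊ : ℝ≥0∞) ^ p) < ⊤) (y : ℝ) (hy : 0 ≤ y) :
    (∫⁻ x : ℝ, (‖f (x + y * Complex.I)‖₊ : ℝ≥0∞) ^ p) ≤
      ENNReal.ofReal (Real.exp (p * Real.pi * y)) *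
        ∫⁻ x : ℝ, (‖f x‖₊ : ℝ≥0∞) ^ p := by
  obtain ⟨hd, hexp⟩ := hf
  set J := ∫⁻ x : ℝ, (‖f x‖₊ : ℝ≥0∞) ^ p with hJ
  have hreal : ∀ N : ℝ, 0 ≤ N → ∀ x : ℝ, ppv f p N x ≤ J.toReal := by
    intro N hN x
    rw [← ENNReal.ofReal_le_iff_le_toReal hLp.ne, pp_ofReal hd.continuous hp hN]
    refine (setLIntegral_le_lintegral _ _).trans ?_
    rw [hJ, ← lintegral_add_left_eq_self (fun t : ℝ => (‖f t‖₊ : ℝ≥0∞) ^ p) x]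
    simp
  have hgrow : ∀ N : ℝ, 0 ≤ N → ∀ ε > 0, ∃ C, 0 ≤ C ∧ ∀ z, ppv f p N z ≤ C * Real.exp (p * (π + ε) * ‖z‖) := by
    intro N hN ε he
    obtain ⟨C, hC, hCb⟩ := hexp ε he
    refine ⟨C ^ p * Real.exp (p * (π + ε) * N) * (2 * N), by positivity, fun z => ?_⟩
    have hb : ∀ t ∈ Set.uIoc (-N) N, ‖‖f (z + t)‖ ^ p‖ ≤ C ^ p * Real.exp (p * (π + ε) * (‖z‖ + N)) := by
      intro t ht
      rw [Set.uIoc_of_le (by linarith)] at ht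
      rw [Real.norm_of_nonneg (by positivity)]
      have h1 : ‖z + t‖ ≤ ‖z‖ + N := by
        refine (norm_add_le _ _).trans ?_
        rw [Complex.norm_real, Real.norm_eq_abs]
        have := abs_le.2 ⟨ht.1.le, ht.2⟩
        linarith
      have h2 : ‖f (z + t)‖ ≤ C * Real.exp ((π + ε) * (‖z‖ + N)) := by
        refine (hCb _).trans ?_
        have := Real.pi_pos
        gcongr
      refine (Real.rpow_le_rpow (norm_nonneg _) h2 hp.le).trans (le_of_eq ?_)
      rw [Real.mul_rpow hC.le (Real.exp_pos _).le, ← Real.exp_mul]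
      congr 2; ring
    have := intervalIntegral.norm_integral_le_of_norm_le_const hb
    refine (le_abs_self _).trans (this.trans (le_of_eq ?_))
    rw [abs_of_nonneg (by linarith), mul_add, Real.exp_add]
    ring
  have hv : ∀ N : ℝ, 0 ≤ N → ppv f p N (y * I) ≤ J.toReal * Real.exp (p * π * y) := by
    intro N hN
    have h1 : ∀ ε > 0, ppv f p N (y * I) ≤ (J.toReal + ε) * Real.exp (p * (π + ε) * y) := by
      intro ε he
      obtain ⟨C, hC, hCb⟩ := hgrow N hN ε he
      have hJ0 : 0 ≤ J.toReal := ENNReal.toReal_nonneg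
      exact pp_half (ppv_class hd hp N hN) (ppv_nonneg f p hN) (by have := Real.pi_pos; positivity) hC
        (by linarith) hCb (fun x => (hreal N hN x).trans (by linarith)) y hy
    have hlim : Filter.Tendsto (fun ε : ℝ => (J.toReal + ε) * Real.exp (p * (π + ε) * y))
        (nhdsWithin 0 (Set.Ioi 0)) (nhds ((J.toReal + 0) * Real.exp (p * (π + 0) * y))) := by
      apply Filter.Tendsto.mono_left _ nhdsWithin_le_nhds
      apply Continuous.tendsto (f := fun ε : ℝ => (J.toReal + ε) * Real.exp (p * (π + ε) * y))
      fun_prop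
    have := ge_of_tendsto hlim (Filter.eventually_of_mem self_mem_nhdsWithin h1)
    simpa using this
  have hN : ∀ N : ℝ, 0 ≤ N → ∫⁻ x : ℝ in Set.Ioc (-N) N, (‖f (x + y * Complex.I)‖₊ : ℝ≥0∞) ^ p
      ≤ ENNReal.ofReal (Real.exp (p * Real.pi * y)) * J := by
    intro N hN
    have h1 := pp_ofReal hd.continuous hp hN (y * I)
    simp only [add_comm _ (y * I)]
    rw [← h1]
    refine (ENNReal.ofReal_le_ofReal (hv N hN)).trans (le_of_eq ?_)
    rw [ENNReal.ofReal_mul ENNReal.toReal_nonneg, ENNReal.ofReal_toReal hLp.ne, mul_comm]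
  have hcov : AECover (volume : Measure ℝ) Filter.atTop (fun N : ℝ => Set.Ioc (-N) N) :=
    aecover_Ioc Filter.tendsto_neg_atTop_atBot Filter.tendsto_id
  have hmeas : AEMeasurable (fun x : ℝ => (‖f (x + y * Complex.I)‖₊ : ℝ≥0∞) ^ p) volume := by
    have : Continuous (fun x : ℝ => ‖f (x + y * Complex.I)‖₊) := by
      have := hd.continuous
      fun_prop
    exact (this.measurable.coe_nnreal_ennreal.pow_const p).aemeasurable
  exact le_of_tendsto (hcov.lintegral_tendsto_of_countably_generated hmeas)
    ((Filter.eventually_ge_atTop 0).mono hN)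

/-- **Plancherel–Pólya.** If `0 < p < ∞` and `f` is entire of exponential type `π`
with `f|ℝ ∈ Lᵖ(ℝ)`, then for every `y ∈ ℝ`,
`∫ |f(x+iy)|^p dx ≤ e^{pπ|y|} ∫ |f(x)|^p dx`. -/
theorem plancherel_polya (p : ℝ) (hp : 0 < p) (f : ℂ → ℂ)
    (hf : ExpTypePi f)
    (hLp : (∫⁻ x : ℝ, (‖f x‖₊ : ℝ≥0∞) ^ p) < ⊤) (y : ℝ) :
    (∫⁻ x : ℝ, (‖f (x + y * Complex.I)‖₊ : ℝ≥0∞) ^ p) ≤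
      ENNReal.ofReal (Real.exp (p * Real.pi * |y|)) *
        ∫⁻ x : ℝ, (‖f x‖₊ : ℝ≥0∞) ^ p := by
  rcases le_total 0 y with hy | hy
  · rw [abs_of_nonneg hy]
    exact pp_upper p hp f hf hLp y hy
  · rw [abs_of_nonpos hy]
    have hg : ExpTypePi (fun z => f (-z)) := by
      refine ⟨hf.1.comp differentiable_neg, fun ε he => ?_⟩
      obtain ⟨C, hC, hb⟩ := hf.2 ε he
      exact ⟨C, hC, fun z => by simpa using hb (-z)⟩
    have e1 : ∫⁻ x : ℝ, (‖f (-(x : ℂ))‖₊ : ℝ≥0∞) ^ p = ∫⁻ x : ℝ, (‖f x‖₊ : ℝ≥0∞) ^ p := by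
      rw [← lintegral_neg_eq_self (fun x : ℝ => (‖f x‖₊ : ℝ≥0∞) ^ p)]
      simp
    have e2 : ∫⁻ x : ℝ, (‖f (-((x : ℂ) + ((-y : ℝ) : ℂ) * I))‖₊ : ℝ≥0∞) ^ p
        = ∫⁻ x : ℝ, (‖f (x + y * I)‖₊ : ℝ≥0∞) ^ p := by
      rw [← lintegral_neg_eq_self (fun x : ℝ => (‖f (x + y * I)‖₊ : ℝ≥0∞) ^ p)]
      congr 1
      ext x
      congr 4
      push_cast
      ring
    have := pp_upper p hp (fun z => f (-z)) hg (by rw [e1]; exact hLp) (-y) (by linarith)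
    rw [e1, e2] at this
    exact this
end

section
/- (Nikolskii-type inequality) Let 0 < p ≤ q < ∞. There is a constant C_{p,q} > 0 such that every f ∈ E^p has restriction to ℝ in L^q(ℝ) and (∫_ℝ |f(x)|^q dx)^{1/q} ≤ C_{p,q} (∫_ℝ |f(x)|^p dx)^{1/p}. In particular E^p ⊆ E^q for 0 < p ≤ q. -/
open MeasureTheory Real Complex
open scoped ENNReal NNReal

/-- An elementary bump: a multiple of the Cauchy kernel with pole below the real axis. -/
noncomputable def nkBump (c a r : ℝ) (z : ℂ) : ℂ :=
  ((2 * c * r : ℝ) : ℂ) * I / (z - a + r * I)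

lemma nkBump_den_im (a r : ℝ) (z : ℂ) : (z - a + r * I).im = z.im + r := by
  simp

lemma nkBump_den_re (a r : ℝ) (z : ℂ) : (z - a + r * I).re = z.re - a := by
  simp

lemma nkBump_den_ne {a r : ℝ} (hr : 0 < r) {z : ℂ} (hz : 0 ≤ z.im) : z - a + r * I ≠ 0 := by
  intro h
  have := nkBump_den_im a r z
  rw [h] at this
  simp at this
  linarith

lemma nkBump_diff {c a r : ℝ} (hr : 0 < r) {z : ℂ} (hz : 0 ≤ z.im) :
    DifferentiableAt ℂ (nkBump c a r) z := by
  unfold nkBump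
  have := nkBump_den_ne (a := a) hr hz
  fun_prop (disch := assumption)

lemma nkBump_re (c a r : ℝ) (z : ℂ) :
    (nkBump c a r z).re = 2 * c * r * (z.im + r) / ((z.re - a) ^ 2 + (z.im + r) ^ 2) := by
  unfold nkBump
  rw [Complex.div_re, Complex.normSq_apply, nkBump_den_im, nkBump_den_re]
  simp
  ring

lemma nkBump_re_nonneg {c a r : ℝ} (hc : 0 ≤ c) (hr : 0 < r) {z : ℂ} (hz : 0 ≤ z.im) :
    0 ≤ (nkBump c a r z).re := by
  rw [nkBump_re]
  positivity

lemma nkBump_re_ge {c a r : ℝ} (hc : 0 ≤ c) (hr : 0 < r) {x : ℝ} (hx : |x - a| ≤ r) :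
    c ≤ (nkBump c a r x).re := by
  rw [nkBump_re, le_div_iff₀ (by simp; positivity)]
  simp only [ofReal_re, ofReal_im, zero_add]
  have : (x - a) ^ 2 ≤ r ^ 2 := sq_le_sq.mpr (by rwa [abs_of_pos hr])
  nlinarith

lemma nkBump_norm {c a r d : ℝ} (hc : 0 ≤ c) (hr : 0 < r) (hd : 0 < d) {z : ℂ}
    (h : d ≤ ‖z - a + r * I‖) : ‖nkBump c a r z‖ ≤ 2 * c * r / d := by
  unfold nkBump
  rw [norm_div, norm_mul, norm_I, mul_one, Complex.norm_real, Real.norm_of_nonneg (by positivity)]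
  gcongr

lemma nk_piece (φ : ℝ → ℝ) (hφ : Continuous φ) (h0 : ∀ x, 0 ≤ φ x) (k : ℤ) (η : ℝ) (hη : 0 < η) :
    ∃ (S : ℂ → ℂ) (B : ℝ), (∀ z : ℂ, 0 ≤ z.im → DifferentiableAt ℂ S z) ∧
      (∀ z : ℂ, 0 ≤ z.im → 0 ≤ (S z).re ∧ ‖S z‖ ≤ B) ∧
      (∀ x : ℝ, x ∈ Set.Icc (k : ℝ) (k + 1) → φ x ≤ (S x).re) ∧
      (∀ z : ℂ, 0 ≤ z.im → (1 ≤ z.im ∨ 2 ≤ |z.re - k|) →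
        ‖S z‖ ≤ 2 * ((∫ x in (k : ℝ)..k + 1, φ x) + 2 * η)) := by
  have huc : UniformContinuousOn φ (Set.Icc (k : ℝ) (k + 1)) :=
    isCompact_Icc.uniformContinuousOn_of_continuous hφ.continuousOn
  rw [Metric.uniformContinuousOn_iff] at huc
  obtain ⟨δ, hδ, huc⟩ := huc η hη
  obtain ⟨n, hn⟩ := exists_nat_one_div_lt hδ
  set N : ℕ := n + 1 with hN
  set r : ℝ := 1 / (N : ℝ) with hr
  have hNpos : (0 : ℝ) < N := by positivity
  have hrpos : 0 < r := by positivity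
  have hNr : N * r = 1 := by rw [hr]; field_simp
  have hrδ : r < δ := by rw [hr, hN]; push_cast; exact hn
  set a : ℕ → ℝ := fun j => k + j * r with ha
  have haS : ∀ j, a (j + 1) = a j + r := by intro j; simp only [ha]; push_cast; ring
  have hak : ∀ j, (k : ℝ) ≤ a j := by intro j; simp only [ha]; have : 0 ≤ j * r := by positivity
                                      linarith
  have hak1 : ∀ j, j ≤ N → a j ≤ k + 1 := by
    intro j hj
    have : (j : ℝ) * r ≤ N * r := by gcongr
    simp only [ha]; linarith
  have hosc : ∀ j, j < N → ∀ x ∈ Set.Icc (a j) (a (j + 1)), |φ x - φ (a j)| < η := by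
    intro j hj x hx
    have h1 := hak j
    have h2 := hak1 (j + 1) hj
    have h3 := haS j
    have := huc x ⟨by linarith [hx.1], by linarith [hx.2]⟩ (a j) ⟨h1, by linarith⟩
      (by rw [Real.dist_eq, abs_of_nonneg (by linarith [hx.1])]; linarith [hx.2])
    rwa [Real.dist_eq] at this
  set c : ℕ → ℝ := fun j => φ (a j) + η with hc
  have hcpos : ∀ j, 0 ≤ c j := by intro j; simp only [hc]; linarith [h0 (a j)]
  have hsum : ∑ j ∈ Finset.range N, c j * r ≤ (∫ x in (k : ℝ)..k + 1, φ x) + 2 * η := by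
    have e1 : (∫ x in (k : ℝ)..k + 1, φ x) =
        ∑ j ∈ Finset.range N, ∫ x in a j..a (j + 1), φ x := by
      rw [intervalIntegral.sum_integral_adjacent_intervals
        (fun j _ => hφ.intervalIntegrable _ _)]
      simp only [ha]
      rw [hNr]
      simp
    have e2 : 2 * η = ∑ j ∈ Finset.range N, 2 * η * r := by
      rw [Finset.sum_const, Finset.card_range, nsmul_eq_mul]
      linear_combination (-2 * η) * hNr
    rw [e1, e2, ← Finset.sum_add_distrib]
    apply Finset.sum_le_sum
    intro j hj
    rw [Finset.mem_range] at hj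
    have h3 := haS j
    have : ∫ x in a j..a (j + 1), (φ (a j) - η) ≤ ∫ x in a j..a (j + 1), φ x := by
      apply intervalIntegral.integral_mono_on (by linarith) (by simp) (hφ.intervalIntegrable _ _)
      intro x hx
      have := (abs_lt.mp (hosc j hj x hx)).1
      linarith
    rw [intervalIntegral.integral_const, h3] at this
    simp only [smul_eq_mul] at this
    rw [h3]
    simp only [hc]
    nlinarith
  refine ⟨fun z => ∑ j ∈ Finset.range N, nkBump (c j) (a j) r z,
    ∑ j ∈ Finset.range N, 2 * c j * r / r, ?_, ?_, ?_, ?_⟩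
  · intro z hz
    exact DifferentiableAt.fun_sum fun j _ => nkBump_diff hrpos hz
  · intro z hz
    refine ⟨?_, ?_⟩
    · rw [Complex.re_sum]
      exact Finset.sum_nonneg fun j _ => nkBump_re_nonneg (hcpos j) hrpos hz
    · refine (norm_sum_le _ _).trans (Finset.sum_le_sum fun j _ => ?_)
      apply nkBump_norm (hcpos j) hrpos hrpos
      have := (le_abs_self _).trans (Complex.abs_im_le_norm (z - a j + r * I))
      rw [nkBump_den_im] at this
      linarith
  · intro x hx
    have hex : ∃ j, j < N ∧ x ∈ Set.Icc (a j) (a (j + 1)) := by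
      by_cases hlt : x = k + 1
      · refine ⟨n, by omega, ?_, ?_⟩
        · rw [hlt]; exact hak1 n (by omega)
        · rw [hlt]; simp only [ha]; rw [← hN, hNr]
      · have hx2 : x < k + 1 := lt_of_le_of_ne hx.2 hlt
        have hx1 := hx.1
        have hnn : 0 ≤ (x - k) * N := mul_nonneg (by linarith) hNpos.le
        refine ⟨⌊(x - k) * N⌋₊, ?_, ?_, ?_⟩
        · rw [Nat.floor_lt hnn]
          nlinarith
        · have := Nat.floor_le hnn
          have : (⌊(x - k) * N⌋₊ : ℝ) * r ≤ (x - k) * N * r := by gcongr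
          simp only [ha]
          rw [mul_assoc, hNr] at this
          linarith
        · have := (Nat.lt_floor_add_one ((x - k) * N)).le
          have : (x - k) * N * r ≤ ((⌊(x - k) * N⌋₊ : ℝ) + 1) * r := by gcongr
          simp only [ha]
          rw [mul_assoc, hNr] at this
          push_cast
          linarith
    obtain ⟨j, hj, hxj⟩ := hex
    rw [Complex.re_sum]
    have h1 : c j ≤ (nkBump (c j) (a j) r x).re := by
      apply nkBump_re_ge (hcpos j) hrpos
      rw [abs_of_nonneg (by linarith [hxj.1])]
      linarith [hxj.2, haS j]
    have h2 := Finset.single_le_sum (f := fun j => (nkBump (c j) (a j) r x).re)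
      (fun i _ => nkBump_re_nonneg (hcpos i) hrpos (by simp)) (Finset.mem_range.mpr hj)
    have h3 := (abs_lt.mp (hosc j hj x hxj)).2
    simp only [hc] at h1 h2 ⊢
    linarith
  · intro z hz hfar
    have : 2 * ∑ j ∈ Finset.range N, c j * r ≤ 2 * ((∫ x in (k : ℝ)..k + 1, φ x) + 2 * η) := by
      linarith
    refine le_trans ?_ this
    rw [Finset.mul_sum]
    refine (norm_sum_le _ _).trans (Finset.sum_le_sum fun j hj => ?_)
    rw [Finset.mem_range] at hj
    have h := nkBump_norm (c := c j) (a := a j) (z := z) (hcpos j) hrpos one_pos ?_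
    · rw [div_one] at h; linarith
    · rcases hfar with h | h
      · have := (le_abs_self _).trans (Complex.abs_im_le_norm (z - a j + r * I))
        rw [nkBump_den_im] at this
        linarith
      · have := (Complex.abs_re_le_norm (z - a j + r * I))
        rw [nkBump_den_re] at this
        refine le_trans ?_ this
        have h1 := hak j
        have h2 := hak1 j hj.le
        rw [le_abs] at h ⊢
        rcases h with h | h
        · left; linarith
        · right; linarith

/-- Phragmén–Lindelöf in the upper half plane. -/
lemma nk_PL (h : ℂ → ℂ) (hd : DiffContOnCl ℂ h {z | 0 < z.im}) (A B M D : ℝ)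
    (hexp : ∀ z : ℂ, 0 ≤ z.im → ‖h z‖ ≤ A * Real.exp (B * ‖z‖))
    (hM : ∀ x : ℝ, ‖h x‖ ≤ M) (hD : ∀ y : ℝ, 0 ≤ y → ‖h (y * I)‖ ≤ D)
    (z : ℂ) (hz : 0 ≤ z.im) : ‖h z‖ ≤ M := by
  have him : ∀ w : ℂ, (w * I).im = w.re := by intro w; simp
  have key : ‖(fun w : ℂ => h (w * I)) (-(z * I))‖ ≤ M := by
    apply PhragmenLindelof.right_half_plane_of_bounded_on_real (f := fun w : ℂ => h (w * I)) (z := -(z * I))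
    · refine hd.comp (g := fun w : ℂ => w * I) ?_ ?_
      · exact Differentiable.diffContOnCl (by fun_prop)
      · intro w hw
        simpa using hw
    · refine ⟨1, by norm_num, B, ?_⟩
      apply Asymptotics.IsBigO.of_bound A
      rw [Filter.eventually_inf_principal]
      refine Filter.Eventually.of_forall fun w hw => ?_
      have := hexp (w * I) (by rw [him]; exact le_of_lt hw)
      simpa using this
    · refine ⟨D, ?_⟩
      rw [Filter.eventually_map]
      filter_upwards [Filter.eventually_ge_atTop 0] with y hy using hD y hy
    · intro x
      have : (x : ℂ) * I * I = ((-x : ℝ) : ℂ) := by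
        rw [mul_assoc, I_mul_I]; push_cast; ring
      simp only [this]
      exact hM _
    · simpa using hz
  have e : -(z * I) * I = z := by rw [neg_mul, mul_assoc, I_mul_I]; ring
  simpa only [e] using key

lemma nk_norm_cexp (a : ℝ) (z : ℂ) : ‖Complex.exp (a * I * z)‖ = Real.exp (-(a * z.im)) := by
  rw [Complex.norm_exp]
  simp

/-- Weighted Phragmén–Lindelöf. -/
lemma nk_PLS (f S : ℂ → ℂ) (hf : Differentiable ℂ f) (hS : DiffContOnCl ℂ S {z | 0 < z.im})
    (hSre : ∀ z : ℂ, 0 ≤ z.im → 0 ≤ (S z).re) (C a M : ℝ)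
    (hC : ∀ z : ℂ, ‖f z‖ ≤ C * Real.exp (a * ‖z‖))
    (hM : ∀ x : ℝ, ‖f x‖ ≤ M * Real.exp (S x).re) (ha : 0 ≤ a)
    (z : ℂ) (hz : 0 ≤ z.im) : ‖f z‖ ≤ M * Real.exp (a * z.im) * Real.exp (S z).re := by
  set h : ℂ → ℂ := fun z => f z * Complex.exp (-S z) * Complex.exp (a * I * z) with hh
  have hC0 : 0 ≤ C := by
    have := (norm_nonneg _).trans (hC 0)
    simpa using this
  have hn : ∀ z, ‖h z‖ = ‖f z‖ * Real.exp (-(S z).re) * Real.exp (-(a * z.im)) := by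
    intro z
    simp only [hh]
    rw [norm_mul, norm_mul, nk_norm_cexp, Complex.norm_exp, Complex.neg_re]
  have hn2 : ∀ z : ℂ, 0 ≤ z.im → ‖h z‖ ≤ C * Real.exp (a * ‖z‖) * 1 * Real.exp (-(a * z.im)) := by
    intro z hz
    rw [hn]
    have h1 : Real.exp (-(S z).re) ≤ 1 := by rw [Real.exp_le_one_iff]; linarith [hSre z hz]
    gcongr
    exact hC z
  have key := nk_PL h ?_ C a M C ?_ ?_ ?_ z hz
  · rw [hn, mul_assoc, ← Real.exp_add] at key
    calc ‖f z‖ = ‖f z‖ * Real.exp (-(S z).re + -(a * z.im)) *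
          (Real.exp (a * z.im) * Real.exp (S z).re) := by
            rw [mul_assoc, ← Real.exp_add, ← Real.exp_add]
            ring_nf
            simp
      _ ≤ M * (Real.exp (a * z.im) * Real.exp (S z).re) := by gcongr
      _ = _ := by ring
  · have h1 : DiffContOnCl ℂ (fun z => Complex.exp (-S z)) {z | 0 < z.im} :=
      ⟨hS.1.neg.cexp, hS.2.neg.cexp⟩
    have h2 : DiffContOnCl ℂ (fun z => Complex.exp (a * I * z)) {z | 0 < z.im} :=
      Differentiable.diffContOnCl (by fun_prop)
    exact (hf.diffContOnCl.smul h1).smul h2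
  · intro z hz
    refine (hn2 z hz).trans ?_
    have : Real.exp (-(a * z.im)) ≤ 1 := by
      rw [Real.exp_le_one_iff]; have := mul_nonneg ha hz; linarith
    calc _ ≤ C * Real.exp (a * ‖z‖) * 1 * 1 := by gcongr
      _ = _ := by ring
  · intro x
    rw [hn]
    simp only [ofReal_im, mul_zero, neg_zero, Real.exp_zero, mul_one]
    calc ‖f x‖ * Real.exp (-(S x).re) ≤ M * Real.exp (S x).re * Real.exp (-(S x).re) := by
          gcongr; exact hM x
      _ = M := by rw [mul_assoc, ← Real.exp_add]; simp
  · intro y hy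
    refine (hn2 _ (by simpa using hy)).trans ?_
    have e1 : ‖(y : ℂ) * I‖ = y := by simp [abs_of_nonneg hy]
    have e2 : ((y : ℂ) * I).im = y := by simp
    rw [e1, e2, mul_one, mul_assoc, ← Real.exp_add]
    simp

/-- Bounded on the real line implies bounded on horizontal strips. -/
lemma nk_strip (f : ℂ → ℂ) (hf : Differentiable ℂ f) (C a M : ℝ)
    (hC : ∀ z : ℂ, ‖f z‖ ≤ C * Real.exp (a * ‖z‖))
    (hM : ∀ x : ℝ, ‖f x‖ ≤ M) (ha : 0 ≤ a) (z : ℂ) :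
    ‖f z‖ ≤ M * Real.exp (a * |z.im|) := by
  have hS : DiffContOnCl ℂ (fun _ : ℂ => (0 : ℂ)) {z | 0 < z.im} := diffContOnCl_const
  rcases le_total 0 z.im with h | h
  · have := nk_PLS f (fun _ => 0) hf hS (by simp) C a M hC (by simpa using hM) ha z h
    simpa [abs_of_nonneg h] using this
  · have := nk_PLS (fun z => f (-z)) (fun _ => 0) (by fun_prop) hS (by simp) C a M
      (fun z => by simpa using hC (-z))
      (fun x => by simpa using hM (-x)) ha (-z) (by simpa using h)
    simpa [abs_of_nonpos h] using this

lemma nk_outer (φ : ℝ → ℝ) (hφ : Continuous φ) (h0 : ∀ x, 0 ≤ φ x) (hi : Integrable φ) :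
    ∃ (S : ℂ → ℂ) (B : ℝ), DiffContOnCl ℂ S {z | 0 < z.im} ∧
      (∀ z : ℂ, 0 ≤ z.im → 0 ≤ (S z).re) ∧
      (∀ x : ℝ, φ x ≤ (S x).re) ∧
      (∀ z : ℂ, 1 ≤ z.im → (S z).re ≤ B) := by
  obtain ⟨η, hη, cη, hηs, -⟩ := NNReal.exists_pos_sum_of_countable (ε := 1) one_ne_zero ℤ
  have hηs' : Summable (fun k : ℤ => (η k : ℝ)) := NNReal.summable_coe.mpr hηs.summable
  choose T B hT1 hT2 hT3 hT4 using fun k : ℤ => nk_piece φ hφ h0 k (η k) (hη k)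
  set s : ℤ → ℝ := fun k => 2 * ((∫ x in (k : ℝ)..k + 1, φ x) + 2 * η k) with hs
  have hss : Summable s := by
    have h1 := (hi.hasSum_intervalIntegral 0).summable
    simp only [zero_add] at h1
    exact (h1.add (hηs'.mul_left 2)).mul_left 2
  -- local uniform bounds
  have hloc : ∀ R : ℝ, ∃ u : ℤ → ℝ, Summable u ∧ ∀ k, ∀ z : ℂ, 0 ≤ z.im → ‖z‖ < R →
      ‖T k z‖ ≤ u k := by
    intro R
    have hfin : {k : ℤ | |(k : ℝ)| < R + 2}.Finite := by
      apply (Set.finite_Icc (-⌈R + 2⌉) ⌈R + 2⌉).subset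
      intro k hk
      have hk' := abs_lt.mp (show |(k : ℝ)| < R + 2 from hk)
      have hc := Int.le_ceil (R + 2)
      constructor
      · have : ((-⌈R + 2⌉ : ℤ) : ℝ) ≤ k := by push_cast; linarith
        exact_mod_cast this
      · have : (k : ℝ) ≤ (⌈R + 2⌉ : ℤ) := by linarith
        exact_mod_cast this
    classical
    refine ⟨fun k => if |(k : ℝ)| < R + 2 then B k else s k, ?_, ?_⟩
    · refine hss.congr_cofinite ?_
      rw [Filter.EventuallyEq, Filter.eventually_cofinite]
      refine hfin.subset ?_
      intro k hk
      by_contra hcon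
      apply hk
      have : ¬ |(k : ℝ)| < R + 2 := hcon
      simp [this]
    · intro k z hz hR
      dsimp only
      split_ifs with hk
      · exact (hT2 k z hz).2
      · apply hT4 k z hz
        right
        have h1 := Complex.abs_re_le_norm z
        have h2 := abs_sub_abs_le_abs_sub (k : ℝ) z.re
        rw [abs_sub_comm] at h2
        linarith
  have hsum : ∀ z : ℂ, 0 ≤ z.im → Summable (fun k => T k z) := by
    intro z hz
    obtain ⟨u, hu, hb⟩ := hloc (‖z‖ + 1)
    exact Summable.of_norm_bounded hu fun k => hb k z hz (by linarith)
  have hre : ∀ z : ℂ, 0 ≤ z.im → HasSum (fun k => (T k z).re) (∑' k, T k z).re := by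
    intro z hz
    exact Complex.hasSum_re (hsum z hz).hasSum
  refine ⟨fun z => ∑' k, T k z, ∑' k, s k, ⟨?_, ?_⟩, ?_, ?_, ?_⟩
  · intro z hz
    obtain ⟨u, hu, hb⟩ := hloc (‖z‖ + 1)
    have hopen : IsOpen ({z : ℂ | 0 < z.im} ∩ Metric.ball 0 (‖z‖ + 1)) :=
      (isOpen_lt continuous_const Complex.continuous_im).inter Metric.isOpen_ball
    have := differentiableOn_tsum_of_summable_norm (F := T) hu
      (U := {z : ℂ | 0 < z.im} ∩ Metric.ball 0 (‖z‖ + 1))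
      (fun k w hw => (hT1 k w (le_of_lt hw.1)).differentiableWithinAt) hopen
      (fun k w hw => hb k w (le_of_lt hw.1) (by simpa using hw.2))
    exact (this.differentiableAt (hopen.mem_nhds ⟨hz, by simp⟩)).differentiableWithinAt
  · have hcl : closure {z : ℂ | 0 < z.im} = {z : ℂ | 0 ≤ z.im} := Complex.closure_setOf_lt_im 0
    rw [hcl]
    intro z hz
    obtain ⟨u, hu, hb⟩ := hloc (‖z‖ + 1)
    have := continuousOn_tsum (f := T) (u := u)
      (s := {z : ℂ | 0 ≤ z.im} ∩ Metric.ball 0 (‖z‖ + 1))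
      (fun k w hw => (hT1 k w hw.1).continuousAt.continuousWithinAt) hu
      (fun k w hw => hb k w hw.1 (by simpa using hw.2))
    have h2 := this z ⟨hz, by simp⟩
    exact (continuousWithinAt_inter (Metric.isOpen_ball.mem_nhds (by simp))).mp h2
  · intro z hz
    exact (hre z hz).nonneg fun k => (hT2 k z hz).1
  · intro x
    have h1 := hT3 ⌊x⌋ x ⟨Int.floor_le x, (Int.lt_floor_add_one x).le⟩
    refine h1.trans ?_
    exact le_hasSum (hre x (by simp)) ⌊x⌋ fun k _ => (hT2 k x (by simp)).1
  · intro z hz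
    have hz0 : 0 ≤ z.im := by linarith
    refine hasSum_le (fun k => ?_) (hre z hz0) hss.hasSum
    exact (Complex.re_le_norm _).trans (hT4 k z hz0 (Or.inl hz))

lemma nk_bounded (p : ℝ) (hp : 0 < p) (f : ℂ → ℂ) (hf : ExpTypePi f)
    (hfi : (∫⁻ x : ℝ, (‖f x‖₊ : ℝ≥0∞) ^ p) < ⊤) : ∃ M : ℝ, ∀ x : ℝ, ‖f x‖ ≤ M := by
  obtain ⟨hd, hgr⟩ := hf
  obtain ⟨C, hC0, hC⟩ := hgr 1 one_pos
  have ha : 0 ≤ Real.pi + 1 := by positivity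
  have hcf : Continuous fun x : ℝ => f x := hd.continuous.comp Complex.continuous_ofReal
  have hcφ : Continuous fun x : ℝ => ‖f x‖ ^ p / p :=
    (hcf.norm.rpow_const fun _ => Or.inr hp.le).div_const p
  have hint : Integrable fun x : ℝ => ‖f x‖ ^ p / p := by
    refine Integrable.div_const ?_ p
    refine ⟨(hcf.norm.rpow_const fun _ => Or.inr hp.le).aestronglyMeasurable, ?_⟩
    rw [HasFiniteIntegral]
    refine lt_of_eq_of_lt (lintegral_congr fun x => ?_) hfi
    rw [Real.enorm_eq_ofReal (by positivity), ← ENNReal.ofReal_rpow_of_nonneg (norm_nonneg _) hp.le,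
      ofReal_norm_eq_enorm]
    rfl
  obtain ⟨S, B, hS, hSre, hSφ, hSB⟩ := nk_outer _ hcφ (fun x => by positivity) hint
  have h1 : ∀ x : ℝ, ‖f (x + I)‖ ≤ Real.exp (Real.pi + 1) * Real.exp B := by
    intro x
    have := nk_PLS f S hd hS hSre C (Real.pi + 1) 1 hC ?_ ha (x + I) (by simp)
    · refine this.trans ?_
      have hB := hSB (x + I) (by simp)
      simp only [add_im, ofReal_im, I_im, zero_add, mul_one, one_mul]
      gcongr
    · intro x
      rw [one_mul]
      refine le_trans ?_ (Real.exp_le_exp.mpr (hSφ x))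
      rcases (norm_nonneg (f x)).eq_or_lt with h | h
      · rw [← h]; positivity
      · calc ‖f x‖ = Real.exp (Real.log ‖f x‖) := (Real.exp_log h).symm
          _ ≤ _ := Real.exp_le_exp.mpr (Real.log_le_rpow_div h.le hp)
  refine ⟨Real.exp (Real.pi + 1) * Real.exp B * Real.exp (Real.pi + 1), fun x => ?_⟩
  have h2 := nk_strip (fun z => f (z + I)) (by fun_prop) (C * Real.exp (Real.pi + 1)) (Real.pi + 1) _ ?_
    h1 ha (x - I)
  · simpa using h2
  · intro z
    refine (hC _).trans ?_
    rw [mul_assoc, ← Real.exp_add]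
    have : ‖z + I‖ ≤ ‖z‖ + 1 := by simpa using norm_add_le z I
    gcongr
    nlinarith

lemma nk_sup (p : ℝ) (hp : 0 < p) : ∃ K : ℝ, 0 < K ∧ ∀ f : ℂ → ℂ, ExpTypePi f →
    (∫⁻ x : ℝ, (‖f x‖₊ : ℝ≥0∞) ^ p) < ⊤ → ∀ x : ℝ, (‖f x‖₊ : ℝ≥0∞) ≤
      ENNReal.ofReal K * (∫⁻ x : ℝ, (‖f x‖₊ : ℝ≥0∞) ^ p) ^ (1 / p) := by
  set L : ℝ := Real.exp (Real.pi + 1) with hL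
  have hL1 : 1 ≤ L := by rw [hL]; exact Real.one_le_exp (by positivity)
  set δ : ℝ := 1 / (8 * L) with hδ
  have hδ0 : 0 < δ := by positivity
  have hδ1 : δ < 1 := by rw [hδ, div_lt_one (by positivity)]; linarith
  refine ⟨4 * (1 / (2 * δ)) ^ (1 / p), by positivity, fun f hf hfi => ?_⟩
  obtain ⟨M₀, hM₀⟩ := nk_bounded p hp f hf hfi
  obtain ⟨hd, hgr⟩ := hf
  obtain ⟨C, hC0, hC⟩ := hgr 1 one_pos
  have hbdd : BddAbove (Set.range fun x : ℝ => ‖f x‖) := ⟨M₀, by rintro _ ⟨x, rfl⟩; exact hM₀ x⟩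
  set M : ℝ := ⨆ x : ℝ, ‖f x‖ with hM
  have hle : ∀ x : ℝ, ‖f x‖ ≤ M := fun x => le_ciSup hbdd x
  have hM0 : 0 ≤ M := (norm_nonneg _).trans (hle 0)
  suffices h : ENNReal.ofReal M ≤ ENNReal.ofReal (4 * (1 / (2 * δ)) ^ (1 / p)) *
      (∫⁻ x : ℝ, (‖f x‖₊ : ℝ≥0∞) ^ p) ^ (1 / p) by
    intro x
    refine le_trans ?_ h
    have : (‖f x‖₊ : ℝ≥0∞) = ENNReal.ofReal ‖f x‖ := (ofReal_norm_eq_enorm _).symm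
    rw [this]
    exact ENNReal.ofReal_le_ofReal (hle x)
  rcases hM0.eq_or_lt with h | hMpos
  · rw [← h]; simp
  obtain ⟨x₀, hx₀⟩ := exists_lt_of_lt_ciSup (show M / 2 < ⨆ x : ℝ, ‖f x‖ by rw [← hM]; linarith)
  have hlow : ∀ x ∈ Set.Icc (x₀ - δ) (x₀ + δ), M / 4 ≤ ‖f x‖ := by
    intro x hx
    have hxd : |x - x₀| ≤ δ := abs_le.mpr ⟨by linarith [hx.1], by linarith [hx.2]⟩
    have hdx : dist (x : ℂ) x₀ = |x - x₀| := by
      rw [Complex.dist_eq, ← Complex.ofReal_sub, Complex.norm_real, Real.norm_eq_abs]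
    have h1 := Complex.dist_le_div_mul_dist_of_mapsTo_ball (f := f) (c := x₀) (z := x) (R₁ := 1)
      (R₂ := 2 * L * M) hd.differentiableOn ?_ (by rw [Metric.mem_ball, hdx]; linarith)
    · rw [hdx, dist_eq_norm] at h1
      have h2 : 2 * L * M / 1 * |x - x₀| ≤ 2 * L * M / 1 * δ := by gcongr
      have h3 : 2 * L * M / 1 * δ = M / 4 := by rw [hδ]; field_simp; norm_num
      have h4 := norm_sub_norm_le (f x₀) (f x)
      rw [norm_sub_rev] at h4
      linarith
    · intro z hz
      rw [Metric.mem_closedBall, dist_eq_norm]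
      have h2 := nk_strip f hd C (Real.pi + 1) M hC hle (by positivity) z
      have h3 : |z.im| ≤ 1 := by
        have := Complex.abs_im_le_norm (z - x₀)
        rw [Metric.mem_ball, Complex.dist_eq] at hz
        simp only [sub_im, ofReal_im, sub_zero] at this
        linarith
      have h4 : Real.exp ((Real.pi + 1) * |z.im|) ≤ L := by
        rw [hL]; apply Real.exp_le_exp.mpr
        have : 0 < Real.pi + 1 := by positivity
        nlinarith
      have h5 := norm_sub_le (f z) (f x₀)
      have h6 := hle x₀
      have h7 : M * Real.exp ((Real.pi + 1) * |z.im|) ≤ M * L := by gcongr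
      nlinarith
  have hint : ENNReal.ofReal (2 * δ) * ENNReal.ofReal (M / 4) ^ p ≤
      ∫⁻ x : ℝ, (‖f x‖₊ : ℝ≥0∞) ^ p := by
    calc ENNReal.ofReal (2 * δ) * ENNReal.ofReal (M / 4) ^ p
        = ∫⁻ _ in Set.Icc (x₀ - δ) (x₀ + δ), ENNReal.ofReal (M / 4) ^ p := by
          rw [setLIntegral_const, Real.volume_Icc, mul_comm]
          congr 2
          ring
      _ ≤ ∫⁻ x in Set.Icc (x₀ - δ) (x₀ + δ), (‖f x‖₊ : ℝ≥0∞) ^ p := by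
          apply setLIntegral_mono' measurableSet_Icc
          intro x hx
          have : (‖f x‖₊ : ℝ≥0∞) = ENNReal.ofReal ‖f x‖ := (ofReal_norm_eq_enorm _).symm
          rw [this]
          gcongr
          exact hlow x hx
      _ ≤ _ := setLIntegral_le_lintegral _ _
  have h2 : (ENNReal.ofReal (2 * δ) * ENNReal.ofReal (M / 4) ^ p) ^ (1 / p) ≤
      (∫⁻ x : ℝ, (‖f x‖₊ : ℝ≥0∞) ^ p) ^ (1 / p) := by gcongr
  refine le_trans (le_of_eq ?_) (mul_le_mul_right h2 _)
  rw [ENNReal.ofReal_rpow_of_nonneg (by positivity) hp.le, ← ENNReal.ofReal_mul (by positivity),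
    ENNReal.ofReal_rpow_of_nonneg (by positivity) (by positivity),
    ← ENNReal.ofReal_mul (by positivity)]
  congr 1
  rw [Real.mul_rpow (by positivity) (by positivity), ← Real.rpow_mul (by positivity),
    mul_one_div_cancel hp.ne', Real.rpow_one, one_div (2 * δ), Real.inv_rpow (by positivity)]
  have : (2 * δ) ^ (1 / p) ≠ 0 := by positivity
  field_simp

/-- **Nikolskii-type inequality.** For `0 < p ≤ q < ∞` there is `C > 0` such that
every `f ∈ Eᵖ` has `f|ℝ ∈ L^q(ℝ)` and `‖f‖_{L^q} ≤ C ‖f‖_{L^p}`.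
In particular `Eᵖ ⊆ E^q`. -/
theorem nikolskii (p q : ℝ) (hp : 0 < p) (hpq : p ≤ q) :
    ∃ C : ℝ, 0 < C ∧ ∀ f : ℂ → ℂ, ExpTypePi f →
      (∫⁻ x : ℝ, (‖f x‖₊ : ℝ≥0∞) ^ p) < ⊤ →
      (∫⁻ x : ℝ, (‖f x‖₊ : ℝ≥0∞) ^ q) < ⊤ ∧
      (∫⁻ x : ℝ, (‖f x‖₊ : ℝ≥0∞) ^ q) ^ (1 / q) ≤
        ENNReal.ofReal C * (∫⁻ x : ℝ, (‖f x‖₊ : ℝ≥0∞) ^ p) ^ (1 / p) := by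
  obtain ⟨K, hK, hsup⟩ := nk_sup p hp
  have hq : 0 < q := hp.trans_le hpq
  refine ⟨K ^ ((q - p) * (1 / q)), by positivity, fun f hf hfi => ?_⟩
  have hs := hsup f hf hfi
  set A := ∫⁻ x : ℝ, (‖f x‖₊ : ℝ≥0∞) ^ p with hA
  have hqp : 0 ≤ q - p := by linarith
  have hm : Measurable fun x : ℝ => (‖f x‖₊ : ℝ≥0∞) ^ p := by
    have : Continuous fun x : ℝ => f x := hf.1.continuous.comp Complex.continuous_ofReal
    exact (this.nnnorm.measurable.coe_nnreal_ennreal).pow_const p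
  have hmain : (∫⁻ x : ℝ, (‖f x‖₊ : ℝ≥0∞) ^ q) ≤
      (ENNReal.ofReal K * A ^ (1 / p)) ^ (q - p) * A := by
    rw [hA, ← lintegral_const_mul _ hm]
    apply lintegral_mono
    intro x
    have e : (‖f x‖₊ : ℝ≥0∞) ^ q = (‖f x‖₊ : ℝ≥0∞) ^ (q - p) * (‖f x‖₊ : ℝ≥0∞) ^ p := by
      rw [← ENNReal.rpow_add_of_nonneg _ _ hqp hp.le]
      congr 1; ring
    dsimp only
    rw [e]
    gcongr
    exact hs x
  have e2 : (ENNReal.ofReal K * A ^ (1 / p)) ^ (q - p) * A =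
      ENNReal.ofReal K ^ (q - p) * A ^ (q / p) := by
    rw [ENNReal.mul_rpow_of_nonneg _ _ hqp, mul_assoc, ← ENNReal.rpow_mul]
    congr 1
    nth_rewrite 2 [← ENNReal.rpow_one A]
    rw [← ENNReal.rpow_add_of_nonneg _ _ (by positivity) one_pos.le]
    congr 1
    field_simp
    ring
  rw [e2] at hmain
  refine ⟨hmain.trans_lt ?_, ?_⟩
  · apply ENNReal.mul_lt_top
    · exact ENNReal.rpow_lt_top_of_nonneg hqp ENNReal.ofReal_ne_top
    · exact ENNReal.rpow_lt_top_of_nonneg (by positivity) hfi.ne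
  · calc _ ≤ (ENNReal.ofReal K ^ (q - p) * A ^ (q / p)) ^ (1 / q) := by gcongr
      _ = _ := by
        rw [ENNReal.mul_rpow_of_nonneg _ _ (by positivity), ← ENNReal.rpow_mul, ← ENNReal.rpow_mul,
          ENNReal.ofReal_rpow_of_pos hK]
        congr 2
        field_simp
end

section
/- Let 0 < p < 1. For every f ∈ E^1 and every ε > 0 there exists g ∈ E^p such that ∫_ℝ |f(x) - g(x)| dx < ε; that is, E^p is a dense subspace of E^1 in the E^1-norm. -/
open MeasureTheory Real Complex
open scoped ENNReal NNReal

/-- The entire sinc function. -/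
noncomputable def csinc : ℂ → ℂ := dslope Complex.sin 0

theorem csinc_differentiable : Differentiable ℂ csinc := by
  rw [← differentiableOn_univ]
  exact (Complex.differentiableOn_dslope Filter.univ_mem).2 Complex.differentiable_sin.differentiableOn

theorem csinc_zero : csinc 0 = 1 := by
  simp [csinc, dslope_same]

theorem csinc_mul (z : ℂ) : z * csinc z = Complex.sin z := by
  have := sub_smul_dslope Complex.sin 0 z
  simpa [csinc] using this

theorem norm_csin_le (z : ℂ) : ‖Complex.sin z‖ ≤ Real.exp ‖z‖ := by
  have h1 : ‖Complex.exp (-z * Complex.I)‖ ≤ Real.exp ‖z‖ := by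
    refine (Complex.norm_exp_le_exp_norm _).trans ?_
    simp
  have h2 : ‖Complex.exp (z * Complex.I)‖ ≤ Real.exp ‖z‖ := by
    refine (Complex.norm_exp_le_exp_norm _).trans ?_
    simp
  have h3 := norm_sub_le (Complex.exp (-z * Complex.I)) (Complex.exp (z * Complex.I))
  rw [Complex.sin]
  simp only [norm_div, norm_mul, Complex.norm_I, mul_one, Complex.norm_ofNat]
  linarith

theorem csinc_bound : ∃ C : ℝ, 1 ≤ C ∧ ∀ z : ℂ, ‖csinc z‖ ≤ C * Real.exp ‖z‖ := by
  obtain ⟨C, hC⟩ := (isCompact_closedBall (0 : ℂ) 1).exists_bound_of_continuousOn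
    csinc_differentiable.continuous.continuousOn
  refine ⟨max C 1, le_max_right _ _, fun z => ?_⟩
  have he : 1 ≤ Real.exp ‖z‖ := Real.one_le_exp (norm_nonneg z)
  have hm : 1 ≤ max C 1 := le_max_right _ _
  by_cases hz : ‖z‖ ≤ 1
  · have := hC z (by simpa using hz)
    have h2 : C ≤ max C 1 := le_max_left _ _
    nlinarith
  · push Not at hz
    have h1 := norm_csin_le z
    rw [← csinc_mul, norm_mul] at h1
    have := norm_nonneg (csinc z)
    nlinarith

theorem csinc_real_mul (x : ℝ) : |x| * ‖csinc x‖ ≤ 1 := by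
  have h := csinc_mul x
  have h2 : ‖(x : ℂ) * csinc x‖ ≤ 1 := by
    rw [h, ← Complex.ofReal_sin, Complex.norm_real]
    exact Real.abs_sin_le_one x
  simpa using h2

theorem csinc_real_le (x : ℝ) : ‖csinc x‖ ≤ 1 := by
  by_cases hx : x = 0
  · subst hx; simp [csinc_zero]
  have h := csinc_mul x
  have h2 : ‖(x : ℂ) * csinc x‖ ≤ |x| := by
    rw [h, ← Complex.ofReal_sin, Complex.norm_real]
    exact Real.abs_sin_le_abs
  rw [norm_mul, Complex.norm_real, Real.norm_eq_abs] at h2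
  have : 0 < |x| := abs_pos.2 hx
  nlinarith

theorem csinc_real_sq (x : ℝ) : ‖csinc x‖ ^ 2 ≤ 2 * (1 + x ^ 2)⁻¹ := by
  have h1 := csinc_real_le x
  have h2 := csinc_real_mul x
  have h0 := norm_nonneg (csinc x)
  have h3 : ‖csinc x‖ ^ 2 ≤ 1 := pow_le_one₀ h0 h1
  have h4 : (|x| * ‖csinc x‖) ^ 2 ≤ 1 := pow_le_one₀ (by positivity) h2
  rw [mul_pow, sq_abs] at h4
  rw [← div_eq_mul_inv, le_div_iff₀ (by positivity)]
  nlinarith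

/-- The approximants. -/
noncomputable def approxG (f : ℂ → ℂ) (N : ℕ) (d : ℝ) (z : ℂ) : ℂ :=
  f (((1 - d : ℝ) : ℂ) * z) * csinc (((Real.pi * d / N : ℝ) : ℂ) * z) ^ N

theorem approxG_type {f : ℂ → ℂ} (hf : ExpTypePi f) {N : ℕ} (hN : 0 < N) {d : ℝ}
    (hd0 : 0 < d) (hd1 : d < 1) : ExpTypePi (approxG f N d) := by
  obtain ⟨hfd, hfb⟩ := hf
  refine ⟨?_, fun ε hε => ?_⟩
  · have := csinc_differentiable
    unfold approxG
    fun_prop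
  · obtain ⟨C, hC, hb⟩ := hfb ε hε
    obtain ⟨K, hK, hs⟩ := csinc_bound
    refine ⟨C * K ^ N, by positivity, fun z => ?_⟩
    have hN' : (0 : ℝ) < N := by exact_mod_cast hN
    have h1 := hb (((1 - d : ℝ) : ℂ) * z)
    have h2 := hs (((Real.pi * d / N : ℝ) : ℂ) * z)
    rw [norm_mul, Complex.norm_real, Real.norm_eq_abs, abs_of_pos (by linarith)] at h1
    rw [norm_mul, Complex.norm_real, Real.norm_eq_abs, abs_of_pos (by positivity)] at h2
    have h3 := pow_le_pow_left₀ (norm_nonneg _) h2 N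
    rw [approxG, norm_mul, norm_pow]
    refine (mul_le_mul h1 h3 (by positivity) (by positivity)).trans ?_
    rw [mul_pow, ← Real.exp_nat_mul]
    have : C * Real.exp ((Real.pi + ε) * ((1 - d) * ‖z‖)) *
        (K ^ N * Real.exp (N * (Real.pi * d / N * ‖z‖))) =
        C * K ^ N * Real.exp ((Real.pi + ε) * ((1 - d) * ‖z‖) + N * (Real.pi * d / N * ‖z‖)) := by
      rw [Real.exp_add]; ring
    rw [this]
    have h5 : N * (Real.pi * d / N * ‖z‖) = Real.pi * d * ‖z‖ := by field_simp
    rw [h5]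
    gcongr
    have : 0 ≤ ε * d * ‖z‖ := by positivity
    nlinarith

theorem approxG_norm_le (f : ℂ → ℂ) (N : ℕ) (d : ℝ) (x : ℝ) :
    ‖approxG f N d x‖ ≤ ‖f (((1 - d) * x : ℝ) : ℂ)‖ := by
  rw [approxG, norm_mul, norm_pow, ← Complex.ofReal_mul, ← Complex.ofReal_mul]
  exact mul_le_of_le_one_right (norm_nonneg _) (pow_le_one₀ (norm_nonneg _) (csinc_real_le _))

theorem approxG_Lp {f : ℂ → ℂ} (hi : Integrable (fun x : ℝ => f x)) {p : ℝ} (hp0 : 0 < p)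
    (hp1 : p < 1) {N : ℕ} (hN : 0 < N) (hNp : 2 ≤ N * (p / (1 - p))) {d : ℝ}
    (hd0 : 0 < d) (hd1 : d < 1) :
    (∫⁻ x : ℝ, (‖approxG f N d x‖₊ : ℝ≥0∞) ^ p) < ⊤ := by
  have hN' : (0 : ℝ) < N := by exact_mod_cast hN
  have hη : Real.pi * d / N ≠ 0 := by positivity
  have hr : 1 - d ≠ 0 := by linarith
  have i1 : Integrable (fun x : ℝ => ‖f (((1 - d) * x : ℝ) : ℂ)‖) := (hi.comp_mul_left' hr).norm
  have i2 : Integrable (fun x : ℝ => 2 * (1 + (Real.pi * d / N * x) ^ 2)⁻¹) :=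
    (integrable_inv_one_add_sq.comp_mul_left' hη).const_mul 2
  have i3 := i1.add i2
  refine lt_of_le_of_lt (lintegral_mono fun x => ?_) i3.lintegral_lt_top
  have h0 : (‖approxG f N d x‖₊ : ℝ≥0∞) ^ p = ENNReal.ofReal (‖approxG f N d x‖ ^ p) := by
    rw [← ENNReal.ofReal_rpow_of_nonneg (norm_nonneg _) hp0.le, ofReal_norm]
    rfl
  rw [h0]
  apply ENNReal.ofReal_le_ofReal
  simp only [Pi.add_apply]
  rw [approxG, norm_mul, norm_pow, ← Complex.ofReal_mul, ← Complex.ofReal_mul,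
    Real.mul_rpow (norm_nonneg _) (by positivity)]
  set a := ‖f (((1 - d) * x : ℝ) : ℂ)‖ with ha
  have hs := csinc_real_sq (Real.pi * d / N * x)
  have hs1 := csinc_real_le (Real.pi * d / N * x)
  set b := ‖csinc ((Real.pi * d / N * x : ℝ) : ℂ)‖ with hb
  have ha0 : 0 ≤ a := norm_nonneg _
  have hb0 : 0 ≤ b := norm_nonneg _
  have hq : 0 < 1 - p := by linarith
  set c := b ^ ((N : ℝ) * (p / (1 - p))) with hc
  have hc0 : 0 ≤ c := Real.rpow_nonneg hb0 _
  have e1 : (b ^ N) ^ p = c ^ (1 - p) := by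
    rw [hc, ← Real.rpow_natCast, ← Real.rpow_mul hb0, ← Real.rpow_mul hb0]
    congr 1
    field_simp
  have e2 : a ^ p * c ^ (1 - p) ≤ p * a + (1 - p) * c :=
    Real.geom_mean_le_arith_mean2_weighted hp0.le hq.le ha0 hc0 (by ring)
  have e3 : c ≤ b ^ 2 := by
    rw [hc, ← Real.rpow_natCast b 2]
    exact Real.rpow_le_rpow_of_exponent_ge' hb0 hs1 (by norm_num) (by exact_mod_cast hNp)
  rw [e1]
  nlinarith

theorem approxG_L1 {f : ℂ → ℂ} (hf : ExpTypePi f) (hi : Integrable (fun x : ℝ => f x))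
    {N : ℕ} (hN : 0 < N) {ε : ℝ} (hε : 0 < ε) :
    ∃ d : ℝ, 0 < d ∧ d < 1 ∧
      (∫⁻ x : ℝ, (‖f x - approxG f N d x‖₊ : ℝ≥0∞)) < ENNReal.ofReal ε := by
  set d : ℕ → ℝ := fun n => 1 / ((n : ℝ) + 1) / 2 with hd
  have hd0 : ∀ n, 0 < d n := fun n => by positivity
  have hd1 : ∀ n, d n < 1 := fun n => by
    have : 1 / ((n : ℝ) + 1) ≤ 1 := by
      rw [div_le_one (by positivity)]
      have : (0 : ℝ) ≤ n := n.cast_nonneg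
      linarith
    simp only [hd]; linarith
  have hdt : Filter.Tendsto d Filter.atTop (nhds 0) := by
    simpa [hd] using tendsto_one_div_add_atTop_nhds_zero_nat (𝕜 := ℝ) |>.div_const 2
  have hfc : Continuous f := hf.1.continuous
  have hsc : Continuous csinc := csinc_differentiable.continuous
  have hgc : ∀ n, Continuous (fun x : ℝ => approxG f N (d n) x) := fun n => by
    unfold approxG; fun_prop
  have hc1 : ∀ n, Integrable (fun x : ℝ => ‖f (((1 - d n) * x : ℝ) : ℂ)‖) := fun n =>
    (hi.comp_mul_left' (by have := hd1 n; linarith)).norm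
  have hgi : ∀ n, Integrable (fun x : ℝ => approxG f N (d n) x) := fun n =>
    (hc1 n).mono' (hgc n).aestronglyMeasurable
      (Filter.Eventually.of_forall fun x => approxG_norm_le f N (d n) x)
  have hfc' : Continuous (fun x : ℝ => f x) := by fun_prop
  have hpt : ∀ x : ℝ, Filter.Tendsto (fun n => approxG f N (d n) x) Filter.atTop (nhds (f x)) := by
    intro x
    have hcont : Continuous (fun t : ℝ => approxG f N t x) := by
      unfold approxG; fun_prop
    have := (hcont.tendsto 0).comp hdt
    simpa [approxG, csinc_zero, Function.comp_def] using this
  have hD : Filter.Tendsto (fun n => ∫ x : ℝ, (‖f x - approxG f N (d n) x‖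
      - ‖approxG f N (d n) x‖ + ‖f x‖)) Filter.atTop (nhds (∫ x : ℝ, (0 : ℝ))) := by
    refine tendsto_integral_of_dominated_convergence (fun x : ℝ => 2 * ‖f x‖) (fun n => ?_)
      (hi.norm.const_mul 2) (fun n => ?_) ?_
    · exact (((hfc'.sub (hgc n)).norm.sub (hgc n).norm).add hfc'.norm).aestronglyMeasurable
    · refine Filter.Eventually.of_forall fun x => ?_
      have h1 := norm_sub_le (f x) (approxG f N (d n) x)
      have h2 := norm_sub_norm_le (approxG f N (d n) x) (f x)
      rw [norm_sub_rev] at h2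
      rw [Real.norm_eq_abs, abs_le]
      constructor <;> linarith [norm_nonneg (f x)]
    · refine Filter.Eventually.of_forall fun x => ?_
      have := (((tendsto_const_nhds (x := f x)).sub (hpt x)).norm.sub (hpt x).norm).add
        (tendsto_const_nhds (x := ‖f x‖))
      simpa using this
  have hM : Filter.Tendsto (fun n => ((1 - d n)⁻¹ - 1) * ∫ x : ℝ, ‖f x‖) Filter.atTop (nhds 0) := by
    have h1 : Filter.Tendsto (fun n => 1 - d n) Filter.atTop (nhds 1) := by
      simpa using hdt.const_sub 1
    have := ((h1.inv₀ one_ne_zero).sub_const 1).mul_const (∫ x : ℝ, ‖f x‖)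
    simpa using this
  have hS := hD.add hM
  simp only [integral_zero, add_zero] at hS
  obtain ⟨n, hn⟩ := (hS.eventually (gt_mem_nhds hε)).exists
  refine ⟨d n, hd0 n, hd1 n, ?_⟩
  have hsub : Integrable (fun x : ℝ => f x - approxG f N (d n) x) := hi.sub (hgi n)
  have e1 : (∫⁻ x : ℝ, (‖f x - approxG f N (d n) x‖₊ : ℝ≥0∞)) =
      ENNReal.ofReal (∫ x : ℝ, ‖f x - approxG f N (d n) x‖) :=
    (ofReal_integral_norm_eq_lintegral_enorm hsub).symm
  rw [e1, ENNReal.ofReal_lt_ofReal_iff hε]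
  have e2 : ∫ x : ℝ, (‖f x - approxG f N (d n) x‖ - ‖approxG f N (d n) x‖ + ‖f x‖) =
      (∫ x : ℝ, ‖f x - approxG f N (d n) x‖) - (∫ x : ℝ, ‖approxG f N (d n) x‖)
        + ∫ x : ℝ, ‖f x‖ := by
    have hh : Integrable (fun x : ℝ => ‖f x - approxG f N (d n) x‖ - ‖approxG f N (d n) x‖) :=
      hsub.norm.sub (hgi n).norm
    rw [integral_add hh hi.norm, integral_sub hsub.norm (hgi n).norm]
  have e3 : ∫ x : ℝ, ‖approxG f N (d n) x‖ ≤ (1 - d n)⁻¹ * ∫ x : ℝ, ‖f x‖ := by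
    refine (integral_mono (hgi n).norm (hc1 n) fun x => approxG_norm_le f N (d n) x).trans ?_
    have := Measure.integral_comp_mul_left (fun x : ℝ => ‖f x‖) (1 - d n)
    rw [this, abs_of_pos (inv_pos.2 (by have := hd1 n; linarith)), smul_eq_mul]
  rw [e2] at hn
  linarith

/-- For `0 < p < 1`, the space `Eᵖ` is dense in `E¹` in the `E¹`-norm. -/
theorem Ep_dense_in_E1 (p : ℝ) (hp0 : 0 < p) (hp1 : p < 1) :
    ∀ f : ℂ → ℂ, ExpTypePi f → Integrable (fun x : ℝ => f x) →
      ∀ ε : ℝ, 0 < ε → ∃ g : ℂ → ℂ, ExpTypePi g ∧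
        (∫⁻ x : ℝ, (‖g x‖₊ : ℝ≥0∞) ^ p) < ⊤ ∧
        (∫⁻ x : ℝ, (‖f x - g x‖₊ : ℝ≥0∞)) < ENNReal.ofReal ε := by
  intro f hf hi ε hε
  have hq : 0 < p / (1 - p) := div_pos hp0 (by linarith)
  obtain ⟨N, hN⟩ := exists_nat_gt (2 / (p / (1 - p)))
  have hN0 : 0 < N := by
    have : (0 : ℝ) < N := lt_trans (by positivity) hN
    exact_mod_cast this
  have hNp : 2 ≤ N * (p / (1 - p)) := ((div_lt_iff₀ hq).1 hN).le
  obtain ⟨d, hd0, hd1, h⟩ := approxG_L1 hf hi hN0 hε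
  exact ⟨approxG f N d, approxG_type hf hN0 hd0 hd1, approxG_Lp hi hp0 hp1 hN0 hNp hd0 hd1, h⟩
end

section
/- Let 0 < p < 1 and α = 1/p - 2. There is a constant C > 0 such that every f ∈ H^p(ℂ_+) satisfies ∫_{ℂ_+} |f(x+iy)| y^α dx dy ≤ C ‖f‖_{H^p(ℂ_+)}; that is, H^p(ℂ_+) embeds continuously into A^{1,α}(ℂ_+). -/
open MeasureTheory Real Complex
open scoped ENNReal NNReal


lemma submean_real {f : ℂ → ℂ} {c : ℂ} {R s : ℝ} (hR : 0 < R) (hs : 0 < s)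
    (hf : AnalyticOnNhd ℂ f (Metric.closedBall c R)) :
    ‖f c‖ ^ s ≤ circleAverage (fun z => ‖f z‖ ^ s) c R := by
  have hR' : |R| = R := abs_of_pos hR
  by_cases h0 : f c = 0
  · rw [h0, norm_zero, Real.zero_rpow hs.ne']
    exact circleAverage_nonneg_of_nonneg (fun x _ => by positivity)
  have hn : 0 < ‖f c‖ := norm_pos_iff.mpr h0
  set l : ℝ := Real.exp (1 / s) / ‖f c‖ with hl
  have hl0 : 0 < l := by positivity
  set g : ℂ → ℂ := fun z => (l : ℂ) * f z with hg
  have hga : AnalyticOnNhd ℂ g (Metric.closedBall c |R|) := by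
    rw [hR']; exact analyticOnNhd_const.mul hf
  have hgc : ‖g c‖ = Real.exp (1 / s) := by
    simp only [hg, norm_mul, Complex.norm_real, Real.norm_of_nonneg hl0.le]
    rw [hl]
    field_simp
  have hgc0 : g c ≠ 0 := by
    rw [← norm_pos_iff, hgc]; positivity
  have hJ := hga.circleAverage_log_norm hR.ne' hgc0
  have hsum : 0 ≤ ∑ᶠ u, (MeromorphicOn.divisor g (Metric.closedBall c |R|) u : ℝ) *
      Real.log (R * ‖c - u‖⁻¹) := by
    apply finsum_nonneg
    intro u
    by_cases hu : u ∈ Metric.closedBall c |R|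
    · apply mul_nonneg
      · have := MeromorphicOn.AnalyticOnNhd.divisor_nonneg hga
        exact_mod_cast this u
      · by_cases huc : c = u
        · simp [huc]
        · apply Real.log_nonneg
          have : 0 < ‖c - u‖ := norm_pos_iff.mpr (sub_ne_zero.mpr huc)
          rw [← div_eq_mul_inv, le_div_iff₀ this, one_mul]
          rw [hR', Metric.mem_closedBall, dist_comm, dist_eq_norm] at hu
          exact hu
    · simp [hu]
  have hlog : 1 / s ≤ circleAverage (fun z => Real.log ‖g z‖) c R := by
    rw [hJ, hgc, Real.log_exp]; linarith
  have hpt : ∀ z, Real.exp 1 * s * Real.log ‖g z‖ ≤ l ^ s * ‖f z‖ ^ s := by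
    intro z
    have : l ^ s * ‖f z‖ ^ s = ‖g z‖ ^ s := by
      rw [← Real.mul_rpow hl0.le (norm_nonneg _)]
      simp only [hg, norm_mul, Complex.norm_real, Real.norm_of_nonneg hl0.le]
    rw [this]
    by_cases hz : g z = 0
    · simp [hz, Real.zero_rpow hs.ne']
    · have hz' : 0 < ‖g z‖ := norm_pos_iff.mpr hz
      rw [Real.rpow_def_of_pos hz']
      have := Real.add_one_le_exp (Real.log ‖g z‖ * s - 1)
      have h2 : Real.exp (Real.log ‖g z‖ * s) = Real.exp 1 * Real.exp (Real.log ‖g z‖ * s - 1) := by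
        rw [← Real.exp_add]; ring_nf
      rw [h2]
      nlinarith [Real.exp_pos 1]
  have hfc : ContinuousOn (fun z => ‖f z‖ ^ s) (Metric.sphere c |R|) := by
    rw [hR']
    have := hf.continuousOn.mono Metric.sphere_subset_closedBall
    exact this.norm.rpow_const (fun _ _ => Or.inr hs.le)
  have hci : CircleIntegrable (fun z => ‖f z‖ ^ s) c R := hfc.circleIntegrable'
  have hli : CircleIntegrable (fun z => Real.log ‖g z‖) c R :=
    (hga.mono Metric.sphere_subset_closedBall).meromorphicOn.circleIntegrable_log_norm
  have hmono := circleAverage_mono (c := c) (R := R) (f₁ := fun z => (Real.exp 1 * s) • Real.log ‖g z‖)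
    (f₂ := fun z => (l ^ s) • ‖f z‖ ^ s) (hli.const_smul) (hci.const_smul)
    (fun z _ => hpt z)
  rw [circleAverage_fun_smul, circleAverage_fun_smul] at hmono
  simp only [smul_eq_mul] at hmono
  have hls : l ^ s * ‖f c‖ ^ s = Real.exp 1 := by
    rw [← Real.mul_rpow hl0.le hn.le, hl, div_mul_cancel₀ _ hn.ne', ← Real.exp_mul]
    congr 1; field_simp
  have h1 : Real.exp 1 * s * (1 / s) ≤ l ^ s * circleAverage (fun z => ‖f z‖ ^ s) c R :=
    le_trans (by gcongr) hmono
  have h3 : Real.exp 1 * s * (1 / s) = Real.exp 1 := by field_simp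
  rw [h3, ← hls] at h1
  exact le_of_mul_le_mul_left h1 (by positivity)

lemma submean {f : ℂ → ℂ} {c : ℂ} {R s : ℝ} (hR : 0 < R) (hs : 0 < s)
    (hf : AnalyticOnNhd ℂ f (Metric.closedBall c R)) :
    ENNReal.ofReal (2 * π) * (‖f c‖₊ : ℝ≥0∞) ^ s ≤
      ∫⁻ θ in Set.Ioo (-π) π, (‖f (circleMap c R θ)‖₊ : ℝ≥0∞) ^ s := by
  have h := submean_real hR hs hf
  rw [circleAverage_eq_integral_add (-π)] at h
  have hcont : Continuous (fun θ => ‖f (circleMap c R θ)‖ ^ s) := by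
    have : Continuous (fun θ => f (circleMap c R θ)) := by
      apply hf.continuousOn.comp_continuous (continuous_circleMap c R)
      intro θ
      exact Metric.sphere_subset_closedBall (circleMap_mem_sphere c hR.le θ)
    exact this.norm.rpow_const (fun _ => Or.inr hs.le)
  have e1 : ∫ θ in 0..2 * π, ‖f (circleMap c R (θ + -π))‖ ^ s
      = ∫ θ in Set.Ioo (-π) π, ‖f (circleMap c R θ)‖ ^ s := by
    rw [intervalIntegral.integral_comp_add_right (fun θ => ‖f (circleMap c R θ)‖ ^ s)]
    rw [intervalIntegral.integral_of_le (by linarith [Real.pi_pos]), integral_Ioc_eq_integral_Ioo]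
    congr 2
    simp; ring_nf
  rw [e1, smul_eq_mul] at h
  have hint : IntegrableOn (fun θ => ‖f (circleMap c R θ)‖ ^ s) (Set.Ioo (-π) π) :=
    (hcont.integrableOn_Icc (a := -π) (b := π)).mono_set Set.Ioo_subset_Icc_self
  have e2 : ∀ z, (‖f z‖₊ : ℝ≥0∞) ^ s = ENNReal.ofReal (‖f z‖ ^ s) := by
    intro z
    rw [← ENNReal.ofReal_rpow_of_nonneg (norm_nonneg _) hs.le, ofReal_norm]
    rfl
  simp_rw [e2]
  rw [← ofReal_integral_eq_lintegral_ofReal hint (Filter.Eventually.of_forall fun _ => by positivity),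
    ← ENNReal.ofReal_mul (by positivity)]
  apply ENNReal.ofReal_le_ofReal
  rwa [← div_eq_inv_mul, le_div_iff₀ (by positivity), mul_comm] at h


lemma lint_pow1 {b r : ℝ} (hb : 0 ≤ b) (hr : -1 < r) :
    ∫⁻ y in Set.Ioc 0 b, ENNReal.ofReal (y ^ r) = ENNReal.ofReal (b ^ (r + 1) / (r + 1)) := by
  have hi : IntervalIntegrable (fun x : ℝ => x ^ r) volume 0 b := intervalIntegral.intervalIntegrable_rpow' hr
  rw [intervalIntegrable_iff_integrableOn_Ioc_of_le hb] at hi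
  rw [← ofReal_integral_eq_lintegral_ofReal hi, ← intervalIntegral.integral_of_le hb,
    integral_rpow (Or.inl hr), Real.zero_rpow (by linarith), sub_zero]
  filter_upwards [ae_restrict_mem measurableSet_Ioc] with y hy
  exact Real.rpow_nonneg hy.1.le _

lemma lint_pow2 {b : ℝ} (hb : 0 < b) :
    ∫⁻ y in Set.Ioi b, ENNReal.ofReal (y ^ (-3 / 2 : ℝ)) = ENNReal.ofReal (2 * b ^ (-1 / 2 : ℝ)) := by
  have hi := integrableOn_Ioi_rpow_of_lt (a := -3 / 2) (by norm_num) hb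
  rw [← ofReal_integral_eq_lintegral_ofReal hi, integral_Ioi_rpow_of_lt (by norm_num) hb]
  · congr 1; norm_num; ring
  filter_upwards [ae_restrict_mem measurableSet_Ioi] with y hy
  exact Real.rpow_nonneg (hb.trans hy).le _

lemma jensen_prob {Ω : Type*} [MeasurableSpace Ω] (μ : Measure Ω) [IsProbabilityMeasure μ] {q : ℝ} (hq : 1 < q)
    {h : Ω → ℝ≥0∞} (hh : Measurable h) : (∫⁻ t, h t ∂μ) ^ q ≤ ∫⁻ t, h t ^ q ∂μ := by
  have := ENNReal.lintegral_mul_le_Lp_mul_Lq μ (Real.HolderConjugate.conjExponent hq) hh.aemeasurable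
    (g := fun _ => 1) aemeasurable_const
  simp only [Pi.mul_apply, mul_one, ENNReal.one_rpow, lintegral_const, measure_univ] at this
  calc _ ≤ ((∫⁻ t, h t ^ q ∂μ) ^ (1 / q)) ^ q := by gcongr
    _ = _ := by rw [← ENNReal.rpow_mul, one_div_mul_cancel (by linarith), ENNReal.rpow_one]

lemma avg_Lq (μ : Measure ℝ) [IsProbabilityMeasure μ] {q : ℝ} (hq : 1 < q) (y : ℝ)
    {h : ℝ → ℝ≥0∞} (hh : Measurable h) :
    ∫⁻ x, (∫⁻ t, h (x + y * t) ∂μ) ^ q ≤ ∫⁻ x, h x ^ q := by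
  calc _ ≤ ∫⁻ x, ∫⁻ t, h (x + y * t) ^ q ∂μ := by
        gcongr with x
        exact jensen_prob μ hq (by fun_prop)
    _ = ∫⁻ t, (∫⁻ x, h (x + y * t) ^ q) ∂μ := by
        rw [lintegral_lintegral_swap]
        apply Measurable.aemeasurable
        fun_prop
    _ = _ := by
        simp [lintegral_add_right_eq_self (fun x => h x ^ q)]

lemma avg_L1 (μ : Measure ℝ) [IsProbabilityMeasure μ] (y : ℝ)
    {h : ℝ → ℝ≥0∞} (hh : Measurable h) :
    ∫⁻ x, (∫⁻ t, h (x + y * t) ∂μ) = ∫⁻ x, h x := by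
  rw [lintegral_lintegral_swap]
  · simp [lintegral_add_right_eq_self (fun x => h x)]
  apply Measurable.aemeasurable
  fun_prop

lemma avg_sup (μ : Measure ℝ) (hμ : μ ≤ volume) {y : ℝ} (hy : 0 < y) (x : ℝ)
    {h : ℝ → ℝ≥0∞} (hh : Measurable h) :
    ∫⁻ t, h (x + y * t) ∂μ ≤ ENNReal.ofReal y⁻¹ * ∫⁻ x, h x := by
  calc _ ≤ ∫⁻ t, h (x + y * t) := lintegral_mono' hμ le_rfl
    _ = ∫⁻ t, h (x + t) ∂(Measure.map (fun t => y * t) volume) := by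
        rw [lintegral_map (by fun_prop) (by fun_prop)]
    _ = ENNReal.ofReal y⁻¹ * ∫⁻ t, h (x + t) := by
        rw [Real.map_volume_mul_left hy.ne', lintegral_smul_measure, abs_of_pos (by positivity)]; rfl
    _ = _ := by rw [lintegral_add_left_eq_self (fun t => h t) x]

/-- The small part. -/
lemma core_small (μ : Measure ℝ) [IsProbabilityMeasure μ] {q N : ℝ} (hq : 2 < q) (hN : 0 < N)
    {g : ℝ → ℝ} (hg : Measurable g) (hg0 : ∀ x, 0 ≤ g x)
    (hgN : ∫⁻ x, ENNReal.ofReal (g x ^ 2) ≤ ENNReal.ofReal N) :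
    ∫⁻ y in Set.Ioi (0:ℝ), ∫⁻ x, (∫⁻ t, (if g (x + y * t) ^ 2 * y ≤ N then
      ENNReal.ofReal (g (x + y * t)) else 0) ∂μ) ^ q * ENNReal.ofReal (y ^ (q / 2 - 2))
      ≤ ENNReal.ofReal (1 / (q / 2 - 1)) * ENNReal.ofReal (N ^ (q / 2)) := by
  have hm : Measurable (fun z : ℝ × ℝ => if g z.2 ^ 2 * z.1 ≤ N then
      ENNReal.ofReal (g z.2) else 0) :=
    Measurable.ite (measurableSet_le (by fun_prop) (by fun_prop)) (by fun_prop) (by fun_prop)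
  have key : ∀ x, ∫⁻ y in Set.Ioi (0:ℝ), (if g x ^ 2 * y ≤ N then ENNReal.ofReal (g x) else 0) ^ q *
      ENNReal.ofReal (y ^ (q / 2 - 2)) ≤
      ENNReal.ofReal (1 / (q / 2 - 1) * N ^ (q / 2 - 1)) * ENNReal.ofReal (g x ^ 2) := by
    intro x
    rcases (hg0 x).eq_or_lt with h0 | h0
    · simp [← h0, ENNReal.zero_rpow_of_pos (show 0 < q by linarith)]
    have : ∀ y ∈ Set.Ioi (0:ℝ), (if g x ^ 2 * y ≤ N then ENNReal.ofReal (g x) else 0) ^ q *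
      ENNReal.ofReal (y ^ (q / 2 - 2)) = (Set.Ioc 0 (N / g x ^ 2)).indicator
        (fun y => ENNReal.ofReal (g x ^ q) * ENNReal.ofReal (y ^ (q / 2 - 2))) y := by
      intro y hy
      have hiff : g x ^ 2 * y ≤ N ↔ y ∈ Set.Ioc 0 (N / g x ^ 2) := by
        rw [Set.mem_Ioc, le_div_iff₀ (by positivity), mul_comm]
        exact ⟨fun h => ⟨hy, h⟩, fun h => h.2⟩
      by_cases hc : g x ^ 2 * y ≤ N
      · rw [if_pos hc, Set.indicator_of_mem (hiff.1 hc), ENNReal.ofReal_rpow_of_pos h0]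
      · rw [if_neg hc, Set.indicator_of_notMem (fun h => hc (hiff.2 h)),
          ENNReal.zero_rpow_of_pos (by linarith), zero_mul]
    rw [setLIntegral_congr_fun measurableSet_Ioi this]
    refine (setLIntegral_le_lintegral _ _).trans ?_
    rw [lintegral_indicator measurableSet_Ioc, lintegral_const_mul _ (by fun_prop),
      lint_pow1 (by positivity) (by linarith), ← ENNReal.ofReal_mul (by positivity),
      ← ENNReal.ofReal_mul (by have : 0 < q / 2 - 1 := by linarith
                               positivity)]
    apply le_of_eq
    congr 1
    rw [show q / 2 - 2 + 1 = q / 2 - 1 by ring, Real.div_rpow hN.le (by positivity),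
      ← Real.rpow_natCast, ← Real.rpow_mul h0.le]
    have : g x ^ q = g x ^ ((2:ℕ):ℝ) * g x ^ (((2:ℕ):ℝ) * (q / 2 - 1)) := by
      rw [← Real.rpow_add h0]; congr 1; push_cast; ring
    rw [this]
    have : 0 < g x ^ (((2:ℕ):ℝ) * (q / 2 - 1)) := by positivity
    field_simp
  calc _ ≤ ∫⁻ y in Set.Ioi (0:ℝ), ∫⁻ x, (if g x ^ 2 * y ≤ N then
      ENNReal.ofReal (g x) else 0) ^ q * ENNReal.ofReal (y ^ (q / 2 - 2)) := by
        apply lintegral_mono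
        intro y
        have hmy : Measurable (fun x => if g x ^ 2 * y ≤ N then ENNReal.ofReal (g x) else 0) :=
          hm.comp (measurable_const.prodMk measurable_id)
        simp only
        rw [lintegral_mul_const' _ _ ENNReal.ofReal_ne_top, lintegral_mul_const' _ _ ENNReal.ofReal_ne_top]
        exact mul_le_mul' (avg_Lq μ (by linarith) y hmy) le_rfl
    _ = ∫⁻ x, ∫⁻ y in Set.Ioi (0:ℝ), (if g x ^ 2 * y ≤ N then
      ENNReal.ofReal (g x) else 0) ^ q * ENNReal.ofReal (y ^ (q / 2 - 2)) := by
        rw [lintegral_lintegral_swap]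
        apply Measurable.aemeasurable
        exact (hm.pow_const q).mul (by fun_prop)
    _ ≤ ∫⁻ x, ENNReal.ofReal (1 / (q / 2 - 1) * N ^ (q / 2 - 1)) * ENNReal.ofReal (g x ^ 2) :=
        lintegral_mono key
    _ ≤ ENNReal.ofReal (1 / (q / 2 - 1) * N ^ (q / 2 - 1)) * ENNReal.ofReal N := by
        rw [lintegral_const_mul' _ _ ENNReal.ofReal_ne_top]
        gcongr
    _ = _ := by
        have : 0 < q / 2 - 1 := by linarith
        rw [← ENNReal.ofReal_mul (by positivity), ← ENNReal.ofReal_mul (by positivity)]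
        congr 1
        rw [mul_assoc, ← Real.rpow_add_one hN.ne']
        congr 2; ring

/-- The large part. -/
lemma core_large (μ : Measure ℝ) [IsProbabilityMeasure μ] (hμ : μ ≤ volume) {q N : ℝ} (hq : 2 < q) (hN : 0 < N)
    {g : ℝ → ℝ} (hg : Measurable g) (hg0 : ∀ x, 0 ≤ g x)
    (hgN : ∫⁻ x, ENNReal.ofReal (g x ^ 2) ≤ ENNReal.ofReal N) :
    ∫⁻ y in Set.Ioi (0:ℝ), ∫⁻ x, (∫⁻ t, (if g (x + y * t) ^ 2 * y ≤ N then
      0 else ENNReal.ofReal (g (x + y * t))) ∂μ) ^ q * ENNReal.ofReal (y ^ (q / 2 - 2))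
      ≤ ENNReal.ofReal 2 * ENNReal.ofReal (N ^ (q / 2)) := by
  have hm : Measurable (fun z : ℝ × ℝ => if g z.2 ^ 2 * z.1 ≤ N then
      0 else ENNReal.ofReal (g z.2)) :=
    Measurable.ite (measurableSet_le (by fun_prop) (by fun_prop)) (by fun_prop) (by fun_prop)
  have key : ∀ x, ∫⁻ y in Set.Ioi (0:ℝ), (if g x ^ 2 * y ≤ N then 0 else ENNReal.ofReal (g x)) *
      ENNReal.ofReal (N ^ ((q - 1) / 2) * y ^ (-3 / 2 : ℝ)) ≤
      ENNReal.ofReal (2 * N ^ (q / 2 - 1)) * ENNReal.ofReal (g x ^ 2) := by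
    intro x
    rcases (hg0 x).eq_or_lt with h0 | h0
    · simp [← h0]
    have : ∀ y ∈ Set.Ioi (0:ℝ), (if g x ^ 2 * y ≤ N then 0 else ENNReal.ofReal (g x)) *
      ENNReal.ofReal (N ^ ((q - 1) / 2) * y ^ (-3 / 2 : ℝ)) = (Set.Ioi (N / g x ^ 2)).indicator
        (fun y => ENNReal.ofReal (g x * N ^ ((q - 1) / 2)) * ENNReal.ofReal (y ^ (-3 / 2 : ℝ))) y := by
      intro y hy
      have hiff : ¬ (g x ^ 2 * y ≤ N) ↔ y ∈ Set.Ioi (N / g x ^ 2) := by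
        rw [Set.mem_Ioi, div_lt_iff₀ (by positivity), mul_comm, not_le]
      by_cases hc : g x ^ 2 * y ≤ N
      · rw [if_pos hc, Set.indicator_of_notMem (fun h => (hiff.2 h) hc), zero_mul]
      · rw [if_neg hc, Set.indicator_of_mem (hiff.1 hc), ENNReal.ofReal_mul (by positivity),
          ENNReal.ofReal_mul (by positivity), mul_assoc]
    rw [setLIntegral_congr_fun measurableSet_Ioi this]
    refine (setLIntegral_le_lintegral _ _).trans ?_
    rw [lintegral_indicator measurableSet_Ioi, lintegral_const_mul _ (by fun_prop),
      lint_pow2 (by positivity), ← ENNReal.ofReal_mul (by positivity),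
      ← ENNReal.ofReal_mul (by positivity)]
    apply le_of_eq
    congr 1
    have e1 : (N / g x ^ 2) ^ (-1 / 2 : ℝ) = N ^ (-1 / 2 : ℝ) * g x := by
      rw [Real.div_rpow hN.le (by positivity), ← Real.rpow_natCast, ← Real.rpow_mul h0.le,
        div_eq_mul_inv, ← Real.rpow_neg h0.le]
      norm_num
    have e2 : N ^ (q / 2 - 1) = N ^ ((q - 1) / 2) * N ^ (-1 / 2 : ℝ) := by
      rw [← Real.rpow_add hN]; congr 1; ring
    rw [e1, e2]; ring
  calc _ ≤ ∫⁻ y in Set.Ioi (0:ℝ), ∫⁻ x, (if g x ^ 2 * y ≤ N then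
      0 else ENNReal.ofReal (g x)) * ENNReal.ofReal (N ^ ((q - 1) / 2) * y ^ (-3 / 2 : ℝ)) := by
        apply setLIntegral_mono' measurableSet_Ioi
        intro y hy
        have hy : 0 < y := hy
        have hmy : Measurable (fun x => if g x ^ 2 * y ≤ N then 0 else ENNReal.ofReal (g x)) :=
          hm.comp (measurable_const.prodMk measurable_id)
        rw [lintegral_mul_const' _ _ ENNReal.ofReal_ne_top, lintegral_mul_const' _ _ ENNReal.ofReal_ne_top]
        set h := fun x => if g x ^ 2 * y ≤ N then 0 else ENNReal.ofReal (g x) with hh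
        have hI : ∫⁻ x, h x ≤ ENNReal.ofReal ((y * N) ^ (1 / 2 : ℝ)) := by
          calc ∫⁻ x, h x ≤ ∫⁻ x, ENNReal.ofReal ((y / N) ^ (1 / 2 : ℝ)) * ENNReal.ofReal (g x ^ 2) := by
                apply lintegral_mono
                intro x
                simp only [hh]
                split_ifs with hc
                · exact bot_le
                · rw [← ENNReal.ofReal_mul (by positivity)]
                  apply ENNReal.ofReal_le_ofReal
                  rw [← Real.sqrt_eq_rpow]
                  have h1 : 1 ≤ √(y / N) * g x := by
                    rw [← Real.sqrt_sq (hg0 x), ← Real.sqrt_mul (by positivity)]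
                    apply Real.one_le_sqrt.mpr
                    rw [div_mul_eq_mul_div, le_div_iff₀ hN]
                    nlinarith
                  nlinarith [hg0 x]
            _ ≤ ENNReal.ofReal ((y / N) ^ (1 / 2 : ℝ)) * ENNReal.ofReal N := by
                rw [lintegral_const_mul' _ _ ENNReal.ofReal_ne_top]
                gcongr
            _ = _ := by
                rw [← ENNReal.ofReal_mul (by positivity)]
                congr 1
                rw [Real.div_rpow hy.le hN.le, Real.mul_rpow hy.le hN.le]
                have : N = N ^ (1 / 2 : ℝ) * N ^ (1 / 2 : ℝ) := by
                  rw [← Real.rpow_add hN]; norm_num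
                have h3 : 0 < N ^ (1 / 2 : ℝ) := by positivity
                rw [div_mul_eq_mul_div, div_eq_iff h3.ne', mul_assoc, ← this]
        have hA : ∀ x, (∫⁻ t, h (x + y * t) ∂μ) ^ q ≤
            ENNReal.ofReal ((N / y) ^ ((q - 1) / 2)) * ∫⁻ t, h (x + y * t) ∂μ := by
          intro x
          have hs : ∫⁻ t, h (x + y * t) ∂μ ≤ ENNReal.ofReal ((N / y) ^ (1 / 2 : ℝ)) := by
            refine (avg_sup μ hμ hy x hmy).trans ?_
            calc _ ≤ ENNReal.ofReal y⁻¹ * ENNReal.ofReal ((y * N) ^ (1 / 2 : ℝ)) := by gcongr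
              _ = _ := by
                rw [← ENNReal.ofReal_mul (by positivity)]
                congr 1
                rw [Real.div_rpow hN.le hy.le, Real.mul_rpow hy.le hN.le]
                have : y = y ^ (1 / 2 : ℝ) * y ^ (1 / 2 : ℝ) := by
                  rw [← Real.rpow_add hy]; norm_num
                have h3 : 0 < y ^ (1 / 2 : ℝ) := by positivity
                rw [inv_mul_eq_div, div_eq_div_iff hy.ne' h3.ne']
                linear_combination (-N ^ (1 / 2 : ℝ)) * this
          rw [show q = (q - 1) + 1 by ring, ENNReal.rpow_add_of_nonneg _ _ (by linarith) zero_le_one,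
            ENNReal.rpow_one]
          gcongr
          calc _ ≤ (ENNReal.ofReal ((N / y) ^ (1 / 2 : ℝ))) ^ (q - 1) := by gcongr; linarith
            _ = _ := by
              rw [ENNReal.ofReal_rpow_of_pos (by positivity), ← Real.rpow_mul (by positivity)]
              congr 2; ring
        calc _ ≤ (ENNReal.ofReal ((N / y) ^ ((q - 1) / 2)) * ∫⁻ x, h x) * ENNReal.ofReal (y ^ (q / 2 - 2)) := by
              gcongr
              refine (lintegral_mono hA).trans ?_
              rw [lintegral_const_mul' _ _ ENNReal.ofReal_ne_top, avg_L1 μ y hmy]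
          _ = _ := by
              rw [mul_comm _ (∫⁻ x, h x), mul_assoc, ← ENNReal.ofReal_mul (by positivity)]
              congr 2
              rw [Real.div_rpow hN.le hy.le, div_mul_eq_mul_div, mul_div_assoc, ← Real.rpow_sub hy]
              congr 2; ring
    _ = ∫⁻ x, ∫⁻ y in Set.Ioi (0:ℝ), (if g x ^ 2 * y ≤ N then
      0 else ENNReal.ofReal (g x)) * ENNReal.ofReal (N ^ ((q - 1) / 2) * y ^ (-3 / 2 : ℝ)) := by
        rw [lintegral_lintegral_swap]
        apply Measurable.aemeasurable
        exact hm.mul (by fun_prop)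
    _ ≤ ∫⁻ x, ENNReal.ofReal (2 * N ^ (q / 2 - 1)) * ENNReal.ofReal (g x ^ 2) :=
        lintegral_mono key
    _ ≤ ENNReal.ofReal (2 * N ^ (q / 2 - 1)) * ENNReal.ofReal N := by
        rw [lintegral_const_mul' _ _ ENNReal.ofReal_ne_top]
        gcongr
    _ = _ := by
        rw [← ENNReal.ofReal_mul (by positivity), ← ENNReal.ofReal_mul (by positivity)]
        congr 1
        rw [mul_assoc, ← Real.rpow_add_one hN.ne']
        congr 2; ring

lemma core (μ : Measure ℝ) [IsProbabilityMeasure μ] (hμ : μ ≤ volume) {q N : ℝ} (hq : 2 < q) (hN : 0 < N)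
    {g : ℝ → ℝ} (hg : Measurable g) (hg0 : ∀ x, 0 ≤ g x)
    (hgN : ∫⁻ x, ENNReal.ofReal (g x ^ 2) ≤ ENNReal.ofReal N) :
    ∫⁻ y in Set.Ioi (0:ℝ), ∫⁻ x, (∫⁻ t, ENNReal.ofReal (g (x + y * t)) ∂μ) ^ q *
      ENNReal.ofReal (y ^ (q / 2 - 2))
      ≤ ENNReal.ofReal (2 ^ (q - 1) * (1 / (q / 2 - 1) + 2)) * ENNReal.ofReal (N ^ (q / 2)) := by
  have hm : Measurable (fun z : ℝ × ℝ => if g z.2 ^ 2 * z.1 ≤ N then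
      ENNReal.ofReal (g z.2) else 0) :=
    Measurable.ite (measurableSet_le (by fun_prop) (by fun_prop)) (by fun_prop) (by fun_prop)
  have hmm : Measurable (fun z : (ℝ × ℝ) × ℝ => (if g (z.1.2 + z.1.1 * z.2) ^ 2 * z.1.1 ≤ N then
      ENNReal.ofReal (g (z.1.2 + z.1.1 * z.2)) else 0)) :=
    hm.comp (g := fun z : ℝ × ℝ => if g z.2 ^ 2 * z.1 ≤ N then
      ENNReal.ofReal (g z.2) else 0) (f := fun z : (ℝ × ℝ) × ℝ => (z.1.1, z.1.2 + z.1.1 * z.2)) (by fun_prop)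
  have hm2 := hmm.lintegral_prod_right' (ν := μ)
  have hm3 : Measurable (fun z : ℝ × ℝ => (∫⁻ t, (if g (z.2 + z.1 * t) ^ 2 * z.1 ≤ N then
      ENNReal.ofReal (g (z.2 + z.1 * t)) else 0) ∂μ) ^ q * ENNReal.ofReal (z.1 ^ (q / 2 - 2))) :=
    (hm2.pow_const q).mul (by fun_prop)
  have hc : (0:ℝ) ≤ 1 / (q / 2 - 1) := by
    have : 0 < q / 2 - 1 := by linarith
    positivity
  have htop : (2 : ℝ≥0∞) ^ (q - 1) ≠ ⊤ := ENNReal.rpow_ne_top_of_nonneg (by linarith) (by simp)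
  calc _ ≤ ∫⁻ y in Set.Ioi (0:ℝ), ∫⁻ x, 2 ^ (q - 1) * ((∫⁻ t, (if g (x + y * t) ^ 2 * y ≤ N then
      ENNReal.ofReal (g (x + y * t)) else 0) ∂μ) ^ q * ENNReal.ofReal (y ^ (q / 2 - 2)) +
      (∫⁻ t, (if g (x + y * t) ^ 2 * y ≤ N then
      0 else ENNReal.ofReal (g (x + y * t))) ∂μ) ^ q * ENNReal.ofReal (y ^ (q / 2 - 2))) := by
        refine lintegral_mono fun y => lintegral_mono fun x => ?_
        simp only
        rw [← add_mul, ← mul_assoc]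
        refine mul_le_mul' ?_ le_rfl
        refine le_trans ?_ (ENNReal.rpow_add_le_mul_rpow_add_rpow _ _ (by linarith))
        gcongr
        have hm5 : Measurable (fun t => if g (x + y * t) ^ 2 * y ≤ N then
            ENNReal.ofReal (g (x + y * t)) else 0) :=
          hm.comp (g := fun z : ℝ × ℝ => if g z.2 ^ 2 * z.1 ≤ N then ENNReal.ofReal (g z.2) else 0)
            (f := fun t : ℝ => (y, x + y * t)) (by fun_prop)
        rw [← lintegral_add_left hm5]
        apply lintegral_mono
        intro t
        simp only
        split_ifs <;> simp
    _ = 2 ^ (q - 1) * ((∫⁻ y in Set.Ioi (0:ℝ), ∫⁻ x, (∫⁻ t, (if g (x + y * t) ^ 2 * y ≤ N then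
      ENNReal.ofReal (g (x + y * t)) else 0) ∂μ) ^ q * ENNReal.ofReal (y ^ (q / 2 - 2))) +
      ∫⁻ y in Set.Ioi (0:ℝ), ∫⁻ x, (∫⁻ t, (if g (x + y * t) ^ 2 * y ≤ N then
      0 else ENNReal.ofReal (g (x + y * t))) ∂μ) ^ q * ENNReal.ofReal (y ^ (q / 2 - 2))) := by
        simp_rw [lintegral_const_mul' _ _ htop]
        congr 1
        have hm4 : Measurable (fun y => ∫⁻ x, (∫⁻ t, (if g (x + y * t) ^ 2 * y ≤ N then
          ENNReal.ofReal (g (x + y * t)) else 0) ∂μ) ^ q * ENNReal.ofReal (y ^ (q / 2 - 2))) :=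
          hm3.lintegral_prod_right'
        rw [← lintegral_add_left hm4]
        congr 1
        ext y
        rw [lintegral_add_left]
        exact hm3.comp (g := fun z : ℝ × ℝ => (∫⁻ t, (if g (z.2 + z.1 * t) ^ 2 * z.1 ≤ N then
      ENNReal.ofReal (g (z.2 + z.1 * t)) else 0) ∂μ) ^ q * ENNReal.ofReal (z.1 ^ (q / 2 - 2)))
          (f := fun x => (y, x)) (by fun_prop)
    _ ≤ 2 ^ (q - 1) * (ENNReal.ofReal (1 / (q / 2 - 1)) * ENNReal.ofReal (N ^ (q / 2)) +
          ENNReal.ofReal 2 * ENNReal.ofReal (N ^ (q / 2))) := by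
        gcongr
        · exact core_small μ hq hN hg hg0 hgN
        · exact core_large μ hμ hq hN hg hg0 hgN
    _ = _ := by
        rw [← add_mul, ← ENNReal.ofReal_add hc (by norm_num), ← mul_assoc, ENNReal.ofReal_mul (by positivity),
          ← ENNReal.ofReal_rpow_of_pos (x := 2) (by norm_num), ENNReal.ofReal_ofNat]


noncomputable def cauchyMeas : Measure ℝ :=
  Measure.map (fun θ => Real.tan (θ / 2)) (ENNReal.ofReal (2 * π)⁻¹ • volume.restrict (Set.Ioo (-π) π))

lemma measurable_tan_half : Measurable (fun θ : ℝ => Real.tan (θ / 2)) := by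
  simp_rw [Real.tan_eq_sin_div_cos]
  fun_prop

lemma lintegral_cauchyMeas {h : ℝ → ℝ≥0∞} (hh : Measurable h) :
    ∫⁻ t, h t ∂cauchyMeas = ENNReal.ofReal (2 * π)⁻¹ * ∫⁻ θ in Set.Ioo (-π) π, h (Real.tan (θ / 2)) := by
  rw [cauchyMeas, lintegral_map hh measurable_tan_half, lintegral_smul_measure]; rfl

instance : IsProbabilityMeasure cauchyMeas := by
  constructor
  rw [← lintegral_one, lintegral_cauchyMeas measurable_const]
  simp only [lintegral_const, one_mul, Measure.restrict_apply_univ, Real.volume_Ioo]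
  rw [← ENNReal.ofReal_mul (by positivity), ← ENNReal.ofReal_one]
  congr 1
  have := Real.pi_pos
  field_simp
  ring

lemma cauchyMeas_le : cauchyMeas ≤ volume := by
  have hpi := Real.pi_gt_three
  rw [Measure.le_iff]
  intro s hs
  rw [← lintegral_indicator_one hs, ← lintegral_indicator_one (μ := volume) hs,
    lintegral_cauchyMeas (measurable_one.indicator hs)]
  have hcos : ∀ θ ∈ Set.Ioo (-π) π, 0 < Real.cos (θ / 2) := fun θ hθ =>
    Real.cos_pos_of_mem_Ioo ⟨by linarith [hθ.1], by linarith [hθ.2]⟩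
  have hd : ∀ θ ∈ Set.Ioo (-π) π, HasDerivWithinAt (fun θ : ℝ => Real.tan (θ / 2))
      (1 / Real.cos (θ / 2) ^ 2 * (1 / 2)) (Set.Ioo (-π) π) θ := by
    intro θ hθ
    have h1 := Real.hasDerivAt_tan (hcos θ hθ).ne'
    have h2 : HasDerivAt (fun θ : ℝ => θ / 2) (1 / 2) θ := (hasDerivAt_id θ).div_const 2
    exact (h1.comp θ h2).hasDerivWithinAt
  have hinj : Set.InjOn (fun θ : ℝ => Real.tan (θ / 2)) (Set.Ioo (-π) π) := by
    intro a ha b hb hab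
    have := Real.injOn_tan ⟨by linarith [ha.1], by linarith [ha.2]⟩
      ⟨by linarith [hb.1], by linarith [hb.2]⟩ hab
    linarith
  have hcv := lintegral_image_eq_lintegral_abs_deriv_mul measurableSet_Ioo hd hinj (s.indicator 1)
  calc _ = ∫⁻ θ in Set.Ioo (-π) π, ENNReal.ofReal (2 * π)⁻¹ * s.indicator 1 (Real.tan (θ / 2)) := by
        rw [lintegral_const_mul' _ _ ENNReal.ofReal_ne_top]
    _ ≤ ∫⁻ θ in Set.Ioo (-π) π, ENNReal.ofReal |1 / Real.cos (θ / 2) ^ 2 * (1 / 2)| *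
          s.indicator 1 (Real.tan (θ / 2)) := by
        apply setLIntegral_mono' measurableSet_Ioo
        intro θ hθ
        gcongr
        have hc := hcos θ hθ
        rw [abs_of_pos (by positivity)]
        have h1 : Real.cos (θ / 2) ^ 2 ≤ 1 := Real.cos_sq_le_one _
        have h2 : 1 ≤ 1 / Real.cos (θ / 2) ^ 2 := by
          rw [le_div_iff₀ (by positivity)]; linarith
        have h3 : (2 * π)⁻¹ ≤ 1 / 2 := by
          rw [inv_le_comm₀ (by positivity) (by norm_num)]; linarith
        linarith
    _ = _ := hcv.symm
    _ ≤ ∫⁻ t, s.indicator 1 t := setLIntegral_le_lintegral _ _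

lemma mobius_im {w : ℂ} (hw : ‖w‖ < 1) : 0 ≤ (Complex.I * ((1 - w) / (1 + w))).im := by
  have h1 : w.re ^ 2 + w.im ^ 2 < 1 := by
    have := Complex.sq_norm w
    rw [Complex.normSq_apply] at this
    nlinarith [norm_nonneg w]
  simp only [Complex.I_mul_im, Complex.div_re, Complex.sub_re, Complex.add_re, Complex.one_re,
    Complex.sub_im, Complex.add_im, Complex.one_im, ← add_div]
  apply div_nonneg _ (Complex.normSq_nonneg _)
  nlinarith

lemma mobius_tan {θ : ℝ} (hθ : θ ∈ Set.Ioo (-π) π) :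
    1 + circleMap 0 1 θ ≠ 0 ∧
    Complex.I * ((1 - circleMap 0 1 θ) / (1 + circleMap 0 1 θ)) = (Real.tan (θ / 2) : ℂ) := by
  have hc : 0 < Real.cos (θ / 2) :=
    Real.cos_pos_of_mem_Ioo ⟨by linarith [hθ.1], by linarith [hθ.2]⟩
  have hc' : (Real.cos (θ / 2) : ℂ) ≠ 0 := by exact_mod_cast hc.ne'
  have hs : (Real.cos (θ / 2) : ℂ) ^ 2 + (Real.sin (θ / 2) : ℂ) ^ 2 = 1 := by
    exact_mod_cast Real.cos_sq_add_sin_sq (θ / 2)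
  set e : ℂ := (Real.cos (θ / 2) : ℂ) + Real.sin (θ / 2) * Complex.I with he
  have hI := Complex.I_sq
  have hw : circleMap 0 1 θ = e ^ 2 := by
    rw [circleMap, he, Complex.ofReal_cos, Complex.ofReal_sin, ← Complex.exp_mul_I, ← Complex.exp_nat_mul]
    push_cast
    rw [zero_add, one_mul]; congr 1; ring
  have h1 : 1 + e ^ 2 = 2 * Real.cos (θ / 2) * e := by
    rw [← hs, he]; linear_combination ((Real.sin (θ / 2) : ℂ) ^ 2) * hI
  have h2 : 1 - e ^ 2 = -2 * Complex.I * Real.sin (θ / 2) * e := by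
    rw [← hs, he]; linear_combination ((Real.sin (θ / 2) : ℂ) ^ 2) * hI
  have he0 : e ≠ 0 := by
    intro h
    have h3 : e * ((Real.cos (θ / 2) : ℂ) - Real.sin (θ / 2) * Complex.I) = 1 := by
      rw [← hs, he]; linear_combination (-(Real.sin (θ / 2) : ℂ) ^ 2) * hI
    rw [h, zero_mul] at h3
    exact zero_ne_one h3
  rw [hw, h1, h2]
  refine ⟨by simp only [ne_eq, mul_eq_zero, he0, hc']; norm_num, ?_⟩
  rw [Real.tan_eq_sin_div_cos]
  push_cast
  push_cast at hc'
  field_simp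
  linear_combination (-Complex.sin (θ / 2)) * hI

lemma poisson_le {f : ℂ → ℂ} (hfm : Measurable f) (hf : DifferentiableOn ℂ f {z : ℂ | 0 < z.im})
    {ε B s : ℝ} (hε : 0 < ε) (hB : ∀ z : ℂ, ε ≤ z.im → ‖f z‖ ≤ B) (hs : 0 < s) {x y : ℝ} (hy : 0 < y) :
    (‖f (x + (y + ε : ℝ) * Complex.I)‖₊ : ℝ≥0∞) ^ s ≤
      ∫⁻ t, (‖f ((x + y * t : ℝ) + ε * Complex.I)‖₊ : ℝ≥0∞) ^ s ∂cauchyMeas := by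
  set φ : ℂ → ℂ := fun w => x + ε * Complex.I + y * (Complex.I * ((1 - w) / (1 + w))) with hφ
  have him : ∀ w, ‖w‖ < 1 → ε ≤ (φ w).im := by
    intro w hw
    have := mobius_im hw
    have e : (φ w).im = ε + y * (Complex.I * ((1 - w) / (1 + w))).im := by
      simp [hφ]
    rw [e]
    nlinarith [mul_nonneg hy.le this]
  have hne : ∀ w : ℂ, ‖w‖ < 1 → 1 + w ≠ 0 := by
    intro w hw h
    have : w = -1 := by linear_combination h
    rw [this] at hw; norm_num at hw
  have hopen : IsOpen {z : ℂ | 0 < z.im} := isOpen_lt continuous_const Complex.continuous_im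
  have hdiff : DifferentiableOn ℂ (fun w => f (φ w)) (Metric.ball 0 1) := by
    refine DifferentiableOn.comp (t := {z : ℂ | 0 < z.im}) hf ?_ ?_
    · intro w hw
      have := hne w (by simpa using hw)
      apply DifferentiableAt.differentiableWithinAt
      simp only [hφ]
      fun_prop (disch := assumption)
    · intro w hw
      exact hε.trans_le (him w (by simpa using hw))
  have hana := hdiff.analyticOnNhd Metric.isOpen_ball
  set r : ℕ → ℝ := fun n => 1 - 1 / ((n : ℝ) + 2) with hr
  have hr0 : ∀ n, 0 < r n := by
    intro n
    simp only [hr, sub_pos]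
    rw [div_lt_one (by positivity)]
    have : (0:ℝ) ≤ n := by positivity
    linarith
  have hr1 : ∀ n, r n < 1 := by
    intro n
    have : 0 < 1 / ((n : ℝ) + 2) := by positivity
    simp only [hr]; linarith
  have hrt : Filter.Tendsto r Filter.atTop (nhds 1) := by
    have : Filter.Tendsto (fun n : ℕ => 1 / ((n : ℝ) + 2)) Filter.atTop (nhds 0) :=
      tendsto_const_nhds.div_atTop (Filter.tendsto_atTop_add_const_right _ _ tendsto_natCast_atTop_atTop)
    simpa [hr] using tendsto_const_nhds.sub this
  have hsub : ∀ n, ENNReal.ofReal (2 * π) * (‖f (φ 0)‖₊ : ℝ≥0∞) ^ s ≤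
      ∫⁻ θ in Set.Ioo (-π) π, (‖f (φ (circleMap 0 (r n) θ))‖₊ : ℝ≥0∞) ^ s := by
    intro n
    exact submean (f := fun w => f (φ w)) (hr0 n) hs
      (hana.mono (Metric.closedBall_subset_ball (hr1 n)))
  have hφm : Measurable φ := by simp only [hφ]; fun_prop
  have hcm : ∀ R, Measurable (fun θ => circleMap 0 R θ) := fun R => (continuous_circleMap 0 R).measurable
  have hlim : Filter.Tendsto (fun n => ∫⁻ θ in Set.Ioo (-π) π, (‖f (φ (circleMap 0 (r n) θ))‖₊ : ℝ≥0∞) ^ s)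
      Filter.atTop (nhds (∫⁻ θ in Set.Ioo (-π) π, (‖f (φ (circleMap 0 1 θ))‖₊ : ℝ≥0∞) ^ s)) := by
    apply tendsto_lintegral_of_dominated_convergence (fun _ => (ENNReal.ofReal B) ^ s)
    · intro n
      have := hφm.comp (hcm (r n))
      exact ((hfm.comp this).nnnorm.coe_nnreal_ennreal).pow_const s
    · intro n
      apply Filter.Eventually.of_forall
      intro θ
      have h1 : ‖f (φ (circleMap 0 (r n) θ))‖ ≤ B := by
        apply hB
        apply him
        rw [norm_circleMap_zero, abs_of_pos (hr0 n)]
        exact hr1 n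
      simp only
      gcongr
      change ‖f (φ (circleMap 0 (r n) θ))‖ₑ ≤ _
      rw [← ofReal_norm]
      exact ENNReal.ofReal_le_ofReal h1
    · simp only [lintegral_const, Measure.restrict_apply_univ, Real.volume_Ioo]
      exact ENNReal.mul_ne_top (ENNReal.rpow_ne_top_of_nonneg hs.le ENNReal.ofReal_ne_top) ENNReal.ofReal_ne_top
    · filter_upwards [ae_restrict_mem measurableSet_Ioo] with θ hθ
      obtain ⟨h0, h1⟩ := mobius_tan hθ
      have hc1 : ContinuousAt φ (circleMap 0 1 θ) := by
        simp only [hφ]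
        fun_prop (disch := assumption)
      have hc2 : ContinuousAt f (φ (circleMap 0 1 θ)) := by
        apply (hf.differentiableAt (hopen.mem_nhds _)).continuousAt
        simp only [hφ, h1, Set.mem_ofPred_eq]
        have : ((x : ℂ) + ε * Complex.I + y * (Real.tan (θ / 2) : ℂ)).im = ε := by
          simp only [Complex.add_im, Complex.mul_im, Complex.ofReal_re, Complex.ofReal_im,
            Complex.I_re, Complex.I_im]
          ring
        rw [this]; exact hε
      have hc3 : Filter.Tendsto (fun n => circleMap 0 (r n) θ) Filter.atTop (nhds (circleMap 0 1 θ)) := by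
        simp only [circleMap]
        exact tendsto_const_nhds.add
          (((Complex.continuous_ofReal.tendsto _).comp hrt).mul tendsto_const_nhds)
      have hc4 : Filter.Tendsto (fun n => f (φ (circleMap 0 (r n) θ))) Filter.atTop
          (nhds (f (φ (circleMap 0 1 θ)))) := (hc2.tendsto.comp hc1.tendsto).comp hc3
      exact (ENNReal.continuous_rpow_const.tendsto _).comp
        ((ENNReal.continuous_coe.tendsto _).comp hc4.nnnorm)
  have hfin := ge_of_tendsto' hlim hsub
  have hm : Measurable fun t : ℝ => (‖f ((x + y * t : ℝ) + ε * Complex.I)‖₊ : ℝ≥0∞) ^ s := by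
    have : Measurable fun t : ℝ => (((x + y * t : ℝ) : ℂ) + ε * Complex.I) := by fun_prop
    exact ((hfm.comp this).nnnorm.coe_nnreal_ennreal).pow_const s
  rw [lintegral_cauchyMeas hm]
  have e1 : ∫⁻ θ in Set.Ioo (-π) π, (‖f (φ (circleMap 0 1 θ))‖₊ : ℝ≥0∞) ^ s =
      ∫⁻ θ in Set.Ioo (-π) π, (‖f ((x + y * Real.tan (θ / 2) : ℝ) + ε * Complex.I)‖₊ : ℝ≥0∞) ^ s := by
    apply setLIntegral_congr_fun measurableSet_Ioo
    intro θ hθ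
    simp only [hφ, (mobius_tan hθ).2]
    push_cast
    ring_nf
  have e0 : φ 0 = x + (y + ε : ℝ) * Complex.I := by
    simp only [hφ]; push_cast; simp; ring
  rw [e1, e0] at hfin
  calc _ = ENNReal.ofReal (2 * π)⁻¹ * (ENNReal.ofReal (2 * π) * (‖f (x + (y + ε : ℝ) * Complex.I)‖₊ : ℝ≥0∞) ^ s) := by
        rw [← mul_assoc, ← ENNReal.ofReal_mul (by positivity), inv_mul_cancel₀ (by positivity)]
        simp
    _ ≤ _ := by gcongr

lemma lintegral_complex {h : ℂ → ℝ≥0∞} (hh : Measurable h) :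
    ∫⁻ z, h z = ∫⁻ y : ℝ, ∫⁻ x : ℝ, h (x + y * Complex.I) := by
  rw [← (Complex.volume_preserving_equiv_real_prod.symm).lintegral_comp hh, Measure.volume_eq_prod,
    lintegral_prod_symm (fun a => h (Complex.measurableEquivRealProd.symm a))
      (hh.comp (MeasurableEquiv.measurable _)).aemeasurable]
  congr! with y x
  exact Complex.mk_eq_add_mul_I _ _

lemma ptwise {f : ℂ → ℂ} (hfm : Measurable f) (hf : DifferentiableOn ℂ f {z : ℂ | 0 < z.im})
    {p : ℝ} (hp : 0 < p) {S : ℝ≥0∞}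
    (hS : ∀ y : ℝ, 0 < y → ∫⁻ x : ℝ, (‖f (x + y * Complex.I)‖₊ : ℝ≥0∞) ^ p ≤ S) (z : ℂ) (hz : 0 < z.im) :
    (‖f z‖₊ : ℝ≥0∞) ^ p ≤ ENNReal.ofReal (8 / π / z.im) * S := by
  set Y := z.im with hY
  set R := Y / 2 with hR
  have hR0 : 0 < R := by positivity
  have hpi := Real.pi_pos
  have hopen : IsOpen {z : ℂ | 0 < z.im} := isOpen_lt continuous_const Complex.continuous_im
  have hball : Metric.ball z Y ⊆ {z : ℂ | 0 < z.im} := by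
    intro w hw
    rw [Metric.mem_ball, dist_eq_norm] at hw
    have := (Complex.abs_im_le_norm (w - z)).trans_lt hw
    rw [Complex.sub_im, abs_lt] at this
    simp only [Set.mem_ofPred_eq]; linarith
  have hana : AnalyticOnNhd ℂ f (Metric.ball z Y) := (hf.analyticOnNhd hopen).mono hball
  set u : ℂ → ℝ≥0∞ := fun w => (‖f w‖₊ : ℝ≥0∞) ^ p with hu
  have hum : Measurable u := (hfm.nnnorm.coe_nnreal_ennreal).pow_const p
  set h : ℂ → ℝ≥0∞ := (Metric.ball 0 R).indicator (fun w => u (z + w)) with hh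
  have hhm : Measurable h := (hum.comp (measurable_const.add measurable_id)).indicator measurableSet_ball
  have hpol := Complex.lintegral_comp_polarCoord_symm h
  have htgt : polarCoord.target = Set.Ioi (0:ℝ) ×ˢ Set.Ioo (-π) π := rfl
  have hsymm : ∀ a : ℝ × ℝ, Complex.polarCoord.symm a = circleMap 0 a.1 a.2 := by
    intro a
    rw [Complex.polarCoord_symm_apply, circleMap, Complex.exp_mul_I, zero_add]
    simp
  have hcm : Measurable (fun a : ℝ × ℝ => circleMap 0 a.1 a.2) := by
    unfold circleMap; fun_prop
  simp_rw [hsymm] at hpol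
  rw [htgt, Measure.volume_eq_prod, ← Measure.prod_restrict, lintegral_prod] at hpol
  swap
  · have h1 : Measurable (fun a : ℝ × ℝ => ENNReal.ofReal a.1) := by fun_prop
    exact (h1.smul (hhm.comp hcm)).aemeasurable
  have low : ENNReal.ofReal (π * R ^ 2) * u z ≤ ∫⁻ w, h w := by
    rw [← hpol]
    calc _ = ∫⁻ r in Set.Ioc 0 R, ENNReal.ofReal r * (ENNReal.ofReal (2 * π) * u z) := by
          rw [lintegral_mul_const _ (by fun_prop)]
          have : ∫⁻ r in Set.Ioc 0 R, ENNReal.ofReal r = ENNReal.ofReal (R ^ 2 / 2) := by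
            have := lint_pow1 (b := R) (r := 1) hR0.le (by norm_num)
            simp only [Real.rpow_one] at this
            rw [this]; norm_num
          rw [this, ← mul_assoc, ← ENNReal.ofReal_mul (by positivity)]
          congr 2; ring
      _ = ∫⁻ r in Set.Ioo 0 R, ENNReal.ofReal r * (ENNReal.ofReal (2 * π) * u z) := by
          rw [restrict_Ioo_eq_restrict_Ioc]
      _ ≤ ∫⁻ r in Set.Ioo 0 R, ∫⁻ θ in Set.Ioo (-π) π, ENNReal.ofReal r • h (circleMap 0 r θ) := by
          apply setLIntegral_mono' measurableSet_Ioo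
          intro r hr
          simp only [smul_eq_mul]
          rw [lintegral_const_mul' _ _ ENNReal.ofReal_ne_top]
          gcongr
          have h1 := submean (f := f) (c := z) hr.1 hp (hana.mono (Metric.closedBall_subset_ball (by linarith [hr.2])))
          refine h1.trans (le_of_eq ?_)
          congr 1
          ext θ
          rw [hh, Set.indicator_of_mem]
          · simp only [hu, circleMap, zero_add]
          · simp [abs_of_pos hr.1, hr.2]
      _ ≤ _ := lintegral_mono_set Set.Ioo_subset_Ioi_self
  have high : ∫⁻ w, h w ≤ ENNReal.ofReal (2 * Y) * S := by
    calc ∫⁻ w, h w = ∫⁻ w, h (w + -z) := (lintegral_add_right_eq_self h (-z)).symm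
      _ ≤ ∫⁻ w, ({w : ℂ | w.im ∈ Set.Ioo 0 (2 * Y)}).indicator u w := by
          apply lintegral_mono
          intro w
          by_cases hw : w + -z ∈ Metric.ball (0:ℂ) R
          · simp only [hh]
            rw [Set.indicator_of_mem hw, Set.indicator_of_mem]
            · simp
            · rw [mem_ball_zero_iff] at hw
              have := (Complex.abs_im_le_norm (w + -z)).trans_lt hw
              rw [Complex.add_im, Complex.neg_im, abs_lt] at this
              exact ⟨by linarith, by linarith⟩
          · simp only [hh]; rw [Set.indicator_of_notMem hw]; exact bot_le
      _ = ∫⁻ y : ℝ, ∫⁻ x : ℝ, ({w : ℂ | w.im ∈ Set.Ioo 0 (2 * Y)}).indicator u (x + y * Complex.I) := by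
          rw [lintegral_complex]
          exact hum.indicator (Complex.measurable_im measurableSet_Ioo)
      _ ≤ ∫⁻ y : ℝ, (Set.Ioo 0 (2 * Y)).indicator (fun _ => S) y := by
          apply lintegral_mono
          intro y
          by_cases hy : y ∈ Set.Ioo 0 (2 * Y)
          · simp only
            rw [Set.indicator_of_mem hy]
            refine le_trans (lintegral_mono fun x => Set.indicator_le_self _ _ _) (hS y hy.1)
          · have : ∀ x : ℝ, ({w : ℂ | w.im ∈ Set.Ioo 0 (2 * Y)}).indicator u (x + y * Complex.I) = 0 := by
              intro x
              apply Set.indicator_of_notMem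
              simpa using hy
            simp only [this]
            simp
      _ = _ := by
          rw [lintegral_indicator measurableSet_Ioo, lintegral_const, Measure.restrict_apply_univ,
            Real.volume_Ioo, sub_zero, mul_comm]
  have hc : ENNReal.ofReal (π * R ^ 2)⁻¹ * (ENNReal.ofReal (π * R ^ 2) * u z) = u z := by
    rw [← mul_assoc, ← ENNReal.ofReal_mul (by positivity), inv_mul_cancel₀ (by positivity)]; simp
  calc u z = _ := hc.symm
    _ ≤ ENNReal.ofReal (π * R ^ 2)⁻¹ * (ENNReal.ofReal (2 * Y) * S) := by
        exact mul_le_mul' le_rfl (low.trans high)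
    _ = _ := by
        rw [← mul_assoc, ← ENNReal.ofReal_mul (by positivity)]
        congr 2
        rw [hR]; field_simp; norm_num

lemma enn_rpow (w : ℂ) {s : ℝ} (hs : 0 ≤ s) : (‖w‖₊ : ℝ≥0∞) ^ s = ENNReal.ofReal (‖w‖ ^ s) := by
  rw [← ENNReal.ofReal_rpow_of_nonneg (norm_nonneg _) hs, ofReal_norm]
  rfl

lemma shifted {p : ℝ} (hp0 : 0 < p) (hp1 : p < 1) {f : ℂ → ℂ} (hfm : Measurable f)
    (hf : DifferentiableOn ℂ f {z : ℂ | 0 < z.im}) {N : ℝ} (hN : 0 < N)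
    (hS : ∀ y : ℝ, 0 < y → ∫⁻ x : ℝ, (‖f (x + y * Complex.I)‖₊ : ℝ≥0∞) ^ p ≤ ENNReal.ofReal N)
    {ε : ℝ} (hε : 0 < ε) :
    ∫⁻ z in {z : ℂ | 0 < z.im}, (‖f (z + ε * Complex.I)‖₊ : ℝ≥0∞) * ENNReal.ofReal (z.im ^ (1 / p - 2)) ≤
      ENNReal.ofReal (2 ^ (2 / p - 1) * (1 / (1 / p - 1) + 2)) * ENNReal.ofReal (N ^ (1 / p)) := by
  have hq : 2 < 2 / p := by rw [lt_div_iff₀ hp0]; linarith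
  have hq2 : 2 / p / 2 = 1 / p := by field_simp
  have hbound : ∀ z : ℂ, ε ≤ z.im → ‖f z‖ ≤ (8 / π / ε * N) ^ (1 / p) := by
    intro z hz
    have hz0 : 0 < z.im := hε.trans_le hz
    have h := ptwise hfm hf hp0 hS z hz0
    have hpi := Real.pi_pos
    rw [enn_rpow _ hp0.le, ← ENNReal.ofReal_mul (by positivity),
      ENNReal.ofReal_le_ofReal_iff (by positivity)] at h
    have h2 : ‖f z‖ ^ p ≤ 8 / π / ε * N := h.trans (by gcongr)
    calc ‖f z‖ = (‖f z‖ ^ p) ^ (1 / p) := by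
          rw [← Real.rpow_mul (norm_nonneg _), mul_one_div_cancel hp0.ne', Real.rpow_one]
      _ ≤ _ := by gcongr
  set g : ℝ → ℝ := fun x => ‖f (x + ε * Complex.I)‖ ^ (p / 2) with hg
  have hgm : Measurable g := by
    have : Measurable fun x : ℝ => ((x : ℂ) + ε * Complex.I) := by fun_prop
    exact (hfm.comp this).norm.pow_const _
  have hgN : ∫⁻ x, ENNReal.ofReal (g x ^ 2) ≤ ENNReal.ofReal N := by
    refine le_trans (le_of_eq ?_) (hS ε hε)
    congr 1; ext x
    rw [enn_rpow _ hp0.le, hg]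
    congr 1
    rw [← Real.rpow_natCast, ← Real.rpow_mul (norm_nonneg _)]
    congr 1; push_cast; ring
  have hcore := core cauchyMeas cauchyMeas_le hq hN hgm (fun x => by positivity) hgN
  rw [hq2] at hcore
  refine le_trans ?_ hcore
  have hset : MeasurableSet {z : ℂ | 0 < z.im} := measurableSet_lt measurable_const Complex.measurable_im
  have hm1 : Measurable fun z : ℂ => (‖f (z + ε * Complex.I)‖₊ : ℝ≥0∞) * ENNReal.ofReal (z.im ^ (1 / p - 2)) := by
    have h1 : Measurable fun z : ℂ => f (z + ε * Complex.I) := hfm.comp (by fun_prop)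
    exact h1.nnnorm.coe_nnreal_ennreal.mul
      ((Complex.measurable_im.pow_const _).ennreal_ofReal)
  rw [← lintegral_indicator hset, lintegral_complex (hm1.indicator hset),
    ← lintegral_indicator measurableSet_Ioi]
  apply lintegral_mono
  intro y
  by_cases hy : 0 < y
  · simp only
    rw [Set.indicator_of_mem (show y ∈ Set.Ioi (0:ℝ) from hy)]
    apply lintegral_mono
    intro x
    simp only
    rw [Set.indicator_of_mem (by simpa using hy)]
    have him : ((x : ℂ) + y * Complex.I).im = y := by simp
    rw [him]
    gcongr
    have hP := poisson_le hfm hf hε hbound (show 0 < p / 2 by positivity) (x := x) hy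
    have e1 : ((x : ℂ) + y * Complex.I + ε * Complex.I) = x + (y + ε : ℝ) * Complex.I := by
      push_cast; ring
    rw [e1]
    calc (‖f (x + (y + ε : ℝ) * Complex.I)‖₊ : ℝ≥0∞)
        = ((‖f (x + (y + ε : ℝ) * Complex.I)‖₊ : ℝ≥0∞) ^ (p / 2)) ^ (2 / p) := by
          rw [← ENNReal.rpow_mul, show p / 2 * (2 / p) = 1 by field_simp, ENNReal.rpow_one]
      _ ≤ _ := by
          apply ENNReal.rpow_le_rpow _ (by positivity)
          refine hP.trans (le_of_eq ?_)
          congr 1; ext t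
          rw [enn_rpow _ (by positivity)]
  · have : ∀ x : ℝ, ({z : ℂ | 0 < z.im}).indicator (fun z : ℂ => (‖f (z + ε * Complex.I)‖₊ : ℝ≥0∞) *
        ENNReal.ofReal (z.im ^ (1 / p - 2))) (x + y * Complex.I) = 0 := by
      intro x
      apply Set.indicator_of_notMem
      simpa using hy
    simp only [this]
    simp

lemma main_measurable {p : ℝ} (hp0 : 0 < p) (hp1 : p < 1) {f : ℂ → ℂ} (hfm : Measurable f)
    (hf : DifferentiableOn ℂ f {z : ℂ | 0 < z.im}) {S : ℝ≥0∞} (hST : S < ⊤)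
    (hS : ∀ y : ℝ, 0 < y → ∫⁻ x : ℝ, (‖f (x + y * Complex.I)‖₊ : ℝ≥0∞) ^ p ≤ S) :
    ∫⁻ z in {z : ℂ | 0 < z.im}, (‖f z‖₊ : ℝ≥0∞) * ENNReal.ofReal (z.im ^ (1 / p - 2)) ≤
      ENNReal.ofReal (2 ^ (2 / p - 1) * (1 / (1 / p - 1) + 2)) * S ^ (1 / p) := by
  have hset : MeasurableSet {z : ℂ | 0 < z.im} := measurableSet_lt measurable_const Complex.measurable_im
  have hopen : IsOpen {z : ℂ | 0 < z.im} := isOpen_lt continuous_const Complex.continuous_im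
  by_cases hS0 : S = 0
  · have : ∀ z ∈ {z : ℂ | 0 < z.im}, (‖f z‖₊ : ℝ≥0∞) * ENNReal.ofReal (z.im ^ (1 / p - 2)) = 0 := by
      intro z hz
      have h := ptwise hfm hf hp0 hS z hz
      rw [hS0, mul_zero, nonpos_iff_eq_zero, ENNReal.rpow_eq_zero_iff_of_pos hp0] at h
      rw [h, zero_mul]
    rw [setLIntegral_congr_fun hset this]
    simp
  set N := S.toReal with hNdef
  have hN : 0 < N := ENNReal.toReal_pos hS0 hST.ne
  have hSN : ENNReal.ofReal N = S := ENNReal.ofReal_toReal hST.ne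
  rw [← hSN] at hS
  rw [← hSN, ENNReal.ofReal_rpow_of_pos hN]
  set e : ℕ → ℝ := fun n => 1 / ((n : ℝ) + 1) with he
  have he0 : ∀ n, 0 < e n := fun n => by positivity
  have het : Filter.Tendsto e Filter.atTop (nhds 0) := tendsto_one_div_add_atTop_nhds_zero_nat
  have hm1 : ∀ n, Measurable fun z : ℂ => (‖f (z + e n * Complex.I)‖₊ : ℝ≥0∞) * ENNReal.ofReal (z.im ^ (1 / p - 2)) := by
    intro n
    have h1 : Measurable fun z : ℂ => f (z + e n * Complex.I) := hfm.comp (by fun_prop)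
    exact h1.nnnorm.coe_nnreal_ennreal.mul
      ((Complex.measurable_im.pow_const _).ennreal_ofReal)
  calc _ = ∫⁻ z in {z : ℂ | 0 < z.im}, Filter.liminf (fun n => (‖f (z + e n * Complex.I)‖₊ : ℝ≥0∞) *
        ENNReal.ofReal (z.im ^ (1 / p - 2))) Filter.atTop := by
        apply setLIntegral_congr_fun hset
        intro z hz
        have hc : ContinuousAt f z := (hf.differentiableAt (hopen.mem_nhds hz)).continuousAt
        have h1 : Filter.Tendsto (fun n => z + e n * Complex.I) Filter.atTop (nhds z) := by
          have := ((Complex.continuous_ofReal.tendsto _).comp het).mul_const Complex.I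
          simpa using this.const_add z
        have h2 := (hc.tendsto.comp h1).nnnorm
        have h3 := (ENNReal.continuous_coe.tendsto _).comp h2
        have h4 := ENNReal.Tendsto.mul_const (b := ENNReal.ofReal (z.im ^ (1 / p - 2))) h3
          (Or.inr ENNReal.ofReal_ne_top)
        exact h4.liminf_eq.symm
    _ ≤ Filter.liminf (fun n => ∫⁻ z in {z : ℂ | 0 < z.im}, (‖f (z + e n * Complex.I)‖₊ : ℝ≥0∞) *
        ENNReal.ofReal (z.im ^ (1 / p - 2))) Filter.atTop := lintegral_liminf_le hm1
    _ ≤ Filter.liminf (fun _ : ℕ => ENNReal.ofReal (2 ^ (2 / p - 1) * (1 / (1 / p - 1) + 2)) *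
          ENNReal.ofReal (N ^ (1 / p))) Filter.atTop :=
        Filter.liminf_le_liminf (Filter.Eventually.of_forall fun n => shifted hp0 hp1 hfm hf hN hS (he0 n))
    _ = _ := Filter.liminf_const _

/-- For `0 < p < 1` and `α = 1/p - 2`, the Hardy space `Hᵖ(ℂ₊)` embeds continuously
into the weighted Bergman space `A^{1,α}(ℂ₊)`:
`∫_{ℂ₊} |f(z)| (Im z)^α dA(z) ≤ C ‖f‖_{Hᵖ(ℂ₊)}`. -/
theorem hardy_embeds_in_bergman_halfplane (p : ℝ) (hp0 : 0 < p) (hp1 : p < 1) :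
    ∃ C : ℝ, 0 < C ∧ ∀ f : ℂ → ℂ,
      DifferentiableOn ℂ f {z : ℂ | 0 < z.im} →
      (⨆ (y : ℝ) (_ : 0 < y), ∫⁻ x : ℝ, (‖f (x + y * Complex.I)‖₊ : ℝ≥0∞) ^ p) < ⊤ →
      (∫⁻ z in {z : ℂ | 0 < z.im},
          (‖f z‖₊ : ℝ≥0∞) * ENNReal.ofReal (z.im ^ (1 / p - 2))) ≤
        ENNReal.ofReal C *
          (⨆ (y : ℝ) (_ : 0 < y),
            ∫⁻ x : ℝ, (‖f (x + y * Complex.I)‖₊ : ℝ≥0∞) ^ p) ^ (1 / p) := by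
  have hr : 1 < 1 / p := by rw [lt_div_iff₀ hp0]; linarith
  have hr' : 0 < 1 / p - 1 := by linarith
  refine ⟨2 ^ (2 / p - 1) * (1 / (1 / p - 1) + 2), by positivity, ?_⟩
  intro f hf hST
  classical
  have hset : MeasurableSet {z : ℂ | 0 < z.im} := measurableSet_lt measurable_const Complex.measurable_im
  set F : ℂ → ℂ := Set.piecewise {z : ℂ | 0 < z.im} f 0 with hF
  have hFe : ∀ z : ℂ, 0 < z.im → F z = f z := fun z hz =>
    Set.piecewise_eq_of_mem {z : ℂ | 0 < z.im} f 0 hz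
  have hFm : Measurable F :=
    ContinuousOn.measurable_piecewise hf.continuousOn continuousOn_const hset
  have hFd : DifferentiableOn ℂ F {z : ℂ | 0 < z.im} := hf.congr hFe
  have hFS : ∀ y : ℝ, 0 < y → ∫⁻ x : ℝ, (‖F (x + y * Complex.I)‖₊ : ℝ≥0∞) ^ p ≤
      ⨆ (y : ℝ) (_ : 0 < y), ∫⁻ x : ℝ, (‖f (x + y * Complex.I)‖₊ : ℝ≥0∞) ^ p := by
    intro y hy
    have e : ∀ x : ℝ, F (x + y * Complex.I) = f (x + y * Complex.I) := fun x => hFe _ (by simpa using hy)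
    simp only [e]
    exact le_iSup₂ (f := fun (y : ℝ) (_ : 0 < y) => ∫⁻ x : ℝ, (‖f (x + y * Complex.I)‖₊ : ℝ≥0∞) ^ p) y hy
  refine le_trans (le_of_eq ?_) (main_measurable hp0 hp1 hFm hFd hST hFS)
  apply setLIntegral_congr_fun hset
  intro z hz
  simp only [hFe z hz]
end
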